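/- Let G be a unicyclic graph and let S be a biactive branch-resolving set in G, with the cycle C canonically labelled with respect to S. If G contains none of the configurations A, D, and E with respect to S, then S is an edge metric generator of G. -/

import Mathlib

open SimpleGraph

section Defs

variable {V : Type*}

/-- Distance from a vertex `s` to an edge `e`: the minimum of the distances to its endpoints. -/
noncomputable def edgeDist (G : SimpleGraph V) (s : V) (e : Sym2 V) : ℕ :=
  Sym2.lift ⟨fun u w => min (G.dist s u) (G.dist s w), fun u w => min_comm _ _⟩ e

/-- `S` is a vertex metric generator of `G`. -/
def IsVertexMG (G : SimpleGraph V) (S : Set V) : Prop :=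
  ∀ u v : V, u ≠ v → ∃ s ∈ S, G.dist s u ≠ G.dist s v

/-- `S` is an edge metric generator of `G`. -/
def IsEdgeMG (G : SimpleGraph V) (S : Set V) : Prop :=
  ∀ e ∈ G.edgeSet, ∀ f ∈ G.edgeSet, e ≠ f → ∃ s ∈ S, edgeDist G s e ≠ edgeDist G s f

/-- The vertex metric dimension of `G`. -/
noncomputable def metricDim (G : SimpleGraph V) : ℕ :=
  sInf {n | ∃ S : Finset V, S.card = n ∧ IsVertexMG G ↑S}

/-- The edge metric dimension of `G`. -/
noncomputable def edgeMetricDim (G : SimpleGraph V) : ℕ :=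
  sInf {n | ∃ S : Finset V, S.card = n ∧ IsEdgeMG G ↑S}

/-- `G` is unicyclic: connected, contains a cycle, and any two cycles have the same edges. -/
def IsUnicyclic (G : SimpleGraph V) : Prop :=
  G.Connected ∧ (∃ (u : V) (w : G.Walk u u), w.IsCycle) ∧
    ∀ (u u' : V) (w : G.Walk u u) (w' : G.Walk u' u'), w.IsCycle → w'.IsCycle →
      ∀ e, e ∈ w.edges ↔ e ∈ w'.edges

/-- `vc : ZMod g → V` is a labelling `v_0 v_1 ⋯ v_{g-1}` of a cycle of length `g` in `G`. -/
def IsCycleLabelling (G : SimpleGraph V) (g : ℕ) (vc : ZMod g → V) : Prop :=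
  Function.Injective vc ∧ ∀ i : ZMod g, G.Adj (vc i) (vc (i + 1))

/-- The set of edges of the cycle `C`. -/
def cycleEdges (g : ℕ) (vc : ZMod g → V) : Set (Sym2 V) :=
  {e | ∃ i : ZMod g, e = s(vc i, vc (i + 1))}

/-- The graph `G - E(C)`. -/
def offCycle (G : SimpleGraph V) (g : ℕ) (vc : ZMod g → V) : SimpleGraph V :=
  G.deleteEdges (cycleEdges g vc)

/-- `x` belongs to `T_{v_i}`, the connected component of `G - E(C)` containing `v_i`. -/
def inTree (G : SimpleGraph V) (g : ℕ) (vc : ZMod g → V) (i : ZMod g) (x : V) : Prop :=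
  (offCycle G g vc).Reachable (vc i) x

/-- The vertex `v_i` of the cycle is `S`-active: `T_{v_i}` contains a vertex of `S`. -/
def SActive (G : SimpleGraph V) (g : ℕ) (vc : ZMod g → V) (S : Set V) (i : ZMod g) : Prop :=
  ∃ s ∈ S, inTree G g vc i s

/-- `a_S(C)`: the number of `S`-active vertices on the cycle. -/
noncomputable def aS (G : SimpleGraph V) (g : ℕ) (vc : ZMod g → V) (S : Set V) : ℕ :=
  {i : ZMod g | SActive G g vc S i}.ncard

/-- `S` is biactive: `a_S(C) ≥ 2`. -/
def Biactive (G : SimpleGraph V) (g : ℕ) (vc : ZMod g → V) (S : Set V) : Prop :=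
  2 ≤ aS G g vc S

variable [Fintype V] [DecidableEq V]

/-- `t = u_1 u_2 ⋯ u_k` is a thread hanging at the vertex `v`. -/
def IsThreadAt (G : SimpleGraph V) [DecidableRel G.Adj] (v : V) (t : List V) : Prop :=
  t ≠ [] ∧ t.Nodup ∧ v ∉ t ∧ 3 ≤ G.degree v ∧ List.Chain' G.Adj t ∧
    (∀ u ∈ t.head?, G.Adj v u) ∧ (∀ u ∈ t.getLast?, G.degree u = 1) ∧
    ∀ u ∈ t.dropLast, G.degree u = 2

/-- The thread `t` is `S`-free: it contains no vertex of `S`. -/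
def SFree (S : Set V) (t : List V) : Prop := ∀ u ∈ t, u ∉ S

/-- `S` is branch-resolving: for every vertex, all threads hanging at it except possibly
one contain a vertex of `S` (i.e. at most one thread at each vertex is `S`-free). -/
def BranchResolving (G : SimpleGraph V) [DecidableRel G.Adj] (S : Set V) : Prop :=
  ∀ v : V, ∀ t₁ t₂ : List V, IsThreadAt G v t₁ → IsThreadAt G v t₂ → t₁ ≠ t₂ →
    (∃ s ∈ S, s ∈ t₁) ∨ (∃ s ∈ S, s ∈ t₂)

/-- `ℓ(v)`: the number of threads hanging at `v`. -/
noncomputable def numThreads (G : SimpleGraph V) [DecidableRel G.Adj] (v : V) : ℕ :=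
  {t : List V | IsThreadAt G v t}.ncard

/-- `L(G) = Σ (ℓ(v) - 1)` (truncated subtraction makes the sum run exactly over the
vertices with `ℓ(v) > 1`). -/
noncomputable def LG (G : SimpleGraph V) [DecidableRel G.Adj] : ℕ :=
  ∑ v : V, (numThreads G v - 1)

/-- `x` is a branching vertex of the unicyclic graph with cycle `vc`. -/
def Branching (G : SimpleGraph V) [DecidableRel G.Adj] (g : ℕ) (vc : ZMod g → V) (x : V) :
    Prop :=
  (x ∉ Set.range vc ∧ 3 ≤ G.degree x) ∨ (x ∈ Set.range vc ∧ 4 ≤ G.degree x)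

/-- The cycle vertex `v_i` is branch-active: `T_{v_i}` contains a branching vertex. -/
def BranchActive (G : SimpleGraph V) [DecidableRel G.Adj] (g : ℕ) (vc : ZMod g → V)
    (i : ZMod g) : Prop :=
  ∃ x, inTree G g vc i x ∧ Branching G g vc x

/-- `b(G)`: the number of branch-active vertices on the cycle. -/
noncomputable def bG (G : SimpleGraph V) [DecidableRel G.Adj] (g : ℕ) (vc : ZMod g → V) : ℕ :=
  {i : ZMod g | BranchActive G g vc i}.ncard

/-- `k = max { i : v_i is S-active }` for the labelling `vc` (indices taken in `[0, g-1]`). -/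
noncomputable def kOf (G : SimpleGraph V) (g : ℕ) (vc : ZMod g → V) (S : Set V) : ℕ :=
  sSup {n : ℕ | n < g ∧ SActive G g vc S (n : ZMod g)}

/-- The labelling `vc` of the cycle is canonical with respect to `S`: `v_0` is `S`-active
and `k` is as small as possible among all labellings of the cycle with `v_0` `S`-active. -/
def Canonical (G : SimpleGraph V) (g : ℕ) (vc : ZMod g → V) (S : Set V) : Prop :=
  IsCycleLabelling G g vc ∧ SActive G g vc S 0 ∧
    ∀ vc' : ZMod g → V, IsCycleLabelling G g vc' → Set.range vc' = Set.range vc →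
      SActive G g vc' S 0 → kOf G g vc S ≤ kOf G g vc' S

/-- Configuration 𝒜 : `a_S(C) = 2`, `g` even and `k = g/2`. -/
def ConfigA (G : SimpleGraph V) (g : ℕ) (vc : ZMod g → V) (S : Set V) : Prop :=
  aS G g vc S = 2 ∧ Even g ∧ kOf G g vc S = g / 2

/-- Configuration ℬ : `k ≤ ⌊g/2⌋ - 1` and an `S`-free thread hangs at `v_i` for some
`i ∈ [k, ⌊g/2⌋-1] ∪ [⌈g/2⌉+k+1, g-1] ∪ {0}`. -/
def ConfigB (G : SimpleGraph V) [DecidableRel G.Adj] (g : ℕ) (vc : ZMod g → V) (S : Set V) :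
    Prop :=
  kOf G g vc S ≤ g / 2 - 1 ∧
    ∃ i : ℕ, ((kOf G g vc S ≤ i ∧ i ≤ g / 2 - 1) ∨
        ((g + 1) / 2 + kOf G g vc S + 1 ≤ i ∧ i ≤ g - 1) ∨ i = 0) ∧
      ∃ t : List V, IsThreadAt G (vc (i : ZMod g)) t ∧ SFree S t

/-- Configuration 𝒞 : `a_S(C) = 2`, `g` even, `k ≤ g/2` and an `S`-free thread of length
`≥ g/2 - k` hangs at `v_i` for some `i ∈ [0, k]`. -/
def ConfigC (G : SimpleGraph V) [DecidableRel G.Adj] (g : ℕ) (vc : ZMod g → V) (S : Set V) :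
    Prop :=
  aS G g vc S = 2 ∧ Even g ∧ kOf G g vc S ≤ g / 2 ∧
    ∃ i : ℕ, i ≤ kOf G g vc S ∧
      ∃ t : List V, IsThreadAt G (vc (i : ZMod g)) t ∧ SFree S t ∧
        g / 2 - kOf G g vc S ≤ t.length

/-- Configuration 𝒟 : `k ≤ ⌈g/2⌉ - 1` and an `S`-free thread hangs at `v_i` for some
`i ∈ [k, ⌈g/2⌉-1] ∪ [⌊g/2⌋+k+1, g-1] ∪ {0}`. -/
def ConfigD (G : SimpleGraph V) [DecidableRel G.Adj] (g : ℕ) (vc : ZMod g → V) (S : Set V) :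
    Prop :=
  kOf G g vc S ≤ (g + 1) / 2 - 1 ∧
    ∃ i : ℕ, ((kOf G g vc S ≤ i ∧ i ≤ (g + 1) / 2 - 1) ∨
        (g / 2 + kOf G g vc S + 1 ≤ i ∧ i ≤ g - 1) ∨ i = 0) ∧
      ∃ t : List V, IsThreadAt G (vc (i : ZMod g)) t ∧ SFree S t

/-- Configuration ℰ : `a_S(C) = 2` and an `S`-free thread of length `≥ ⌊g/2⌋ - k + 1`
hangs at `v_i` with `i ∈ [0, k]`; moreover if `g` is even an `S`-free thread hangs at
`v_j` with `j = g/2 + k - i`. -/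
def ConfigE (G : SimpleGraph V) [DecidableRel G.Adj] (g : ℕ) (vc : ZMod g → V) (S : Set V) :
    Prop :=
  aS G g vc S = 2 ∧
    ∃ i : ℕ, i ≤ kOf G g vc S ∧
      (∃ t : List V, IsThreadAt G (vc (i : ZMod g)) t ∧ SFree S t ∧
        g / 2 - kOf G g vc S + 1 ≤ t.length) ∧
      (Even g → ∃ t' : List V,
        IsThreadAt G (vc ((g / 2 + kOf G g vc S - i : ℕ) : ZMod g)) t' ∧ SFree S t')

/-- `G` contains configuration 𝒜 with respect to `S` (evaluated on a canonical labelling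
of the cycle given by `vc`). -/
def ContainsA (G : SimpleGraph V) (g : ℕ) (vc : ZMod g → V) (S : Set V) : Prop :=
  ∃ vc' : ZMod g → V, IsCycleLabelling G g vc' ∧ Set.range vc' = Set.range vc ∧
    Canonical G g vc' S ∧ ConfigA G g vc' S

/-- `G` contains configuration ℬ with respect to `S`. -/
def ContainsB (G : SimpleGraph V) [DecidableRel G.Adj] (g : ℕ) (vc : ZMod g → V)
    (S : Set V) : Prop :=
  ∃ vc' : ZMod g → V, IsCycleLabelling G g vc' ∧ Set.range vc' = Set.range vc ∧
    Canonical G g vc' S ∧ ConfigB G g vc' S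

/-- `G` contains configuration 𝒞 with respect to `S`. -/
def ContainsC (G : SimpleGraph V) [DecidableRel G.Adj] (g : ℕ) (vc : ZMod g → V)
    (S : Set V) : Prop :=
  ∃ vc' : ZMod g → V, IsCycleLabelling G g vc' ∧ Set.range vc' = Set.range vc ∧
    Canonical G g vc' S ∧ ConfigC G g vc' S

/-- `G` contains configuration 𝒟 with respect to `S`. -/
def ContainsD (G : SimpleGraph V) [DecidableRel G.Adj] (g : ℕ) (vc : ZMod g → V)
    (S : Set V) : Prop :=
  ∃ vc' : ZMod g → V, IsCycleLabelling G g vc' ∧ Set.range vc' = Set.range vc ∧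
    Canonical G g vc' S ∧ ConfigD G g vc' S

/-- `G` contains configuration ℰ with respect to `S`. -/
def ContainsE (G : SimpleGraph V) [DecidableRel G.Adj] (g : ℕ) (vc : ZMod g → V)
    (S : Set V) : Prop :=
  ∃ vc' : ZMod g → V, IsCycleLabelling G g vc' ∧ Set.range vc' = Set.range vc ∧
    Canonical G g vc' S ∧ ConfigE G g vc' S

/-- `G` contains one of the configurations 𝒜, ℬ, 𝒞 with respect to `S`. -/
def ContainsABC (G : SimpleGraph V) [DecidableRel G.Adj] (g : ℕ) (vc : ZMod g → V)
    (S : Set V) : Prop :=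
  ContainsA G g vc S ∨ ContainsB G g vc S ∨ ContainsC G g vc S

/-- `G` contains one of the configurations 𝒜, 𝒟, ℰ with respect to `S`. -/
def ContainsADE (G : SimpleGraph V) [DecidableRel G.Adj] (g : ℕ) (vc : ZMod g → V)
    (S : Set V) : Prop :=
  ContainsA G g vc S ∨ ContainsD G g vc S ∨ ContainsE G g vc S

/-- `S` is a smallest branch-resolving set of `G`. -/
def SmallestBR (G : SimpleGraph V) [DecidableRel G.Adj] (S : Finset V) : Prop :=
  BranchResolving G ↑S ∧ ∀ S' : Finset V, BranchResolving G ↑S' → S.card ≤ S'.card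

/-- `S` is a smallest biactive branch-resolving set of `G`. -/
def SmallestBBR (G : SimpleGraph V) [DecidableRel G.Adj] (g : ℕ) (vc : ZMod g → V)
    (S : Finset V) : Prop :=
  BranchResolving G ↑S ∧ Biactive G g vc ↑S ∧
    ∀ S' : Finset V, BranchResolving G ↑S' → Biactive G g vc ↑S' → S.card ≤ S'.card

/-- `G` is 𝒜ℬ𝒞-negative. -/
def ABCneg (G : SimpleGraph V) [DecidableRel G.Adj] (g : ℕ) (vc : ZMod g → V) : Prop :=
  ∃ S : Finset V, SmallestBBR G g vc S ∧ ¬ ContainsABC G g vc ↑S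

/-- `G` is 𝒜𝒟ℰ-negative. -/
def ADEneg (G : SimpleGraph V) [DecidableRel G.Adj] (g : ℕ) (vc : ZMod g → V) : Prop :=
  ∃ S : Finset V, SmallestBBR G g vc S ∧ ¬ ContainsADE G g vc ↑S

end Defs

theorem dist_eq_add_of_separates {V : Type*} {G : SimpleGraph V} (hG : G.Connected) {B : Set V}
    {c s z : V} (hB : ∀ u ∈ B, ∀ w ∉ B, G.Adj u w → c = u ∨ c = w) (hs : s ∈ B) (hz : z ∉ B) :
    G.dist s z = G.dist s c + G.dist c z := by
  classical
  have key : ∀ {s z : V} (p : G.Walk s z), s ∈ B → z ∉ B → c ∈ p.support := by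
    intro s z p
    induction p with
    | nil => intro h h'; exact absurd h h'
    | @cons u v w h p ih =>
      intro hu hw
      by_cases hv : v ∈ B
      · simp [ih hv hw]
      · rcases hB u hu v hv h with rfl | rfl <;> simp
  obtain ⟨p, hp⟩ := hG.exists_walk_length_eq_dist s z
  have hc := key p hs hz
  have hlen : (p.takeUntil c hc).length + (p.dropUntil c hc).length = p.length := by
    rw [← Walk.length_append, Walk.take_spec]
  have h1 := dist_le (p.takeUntil c hc)
  have h2 := dist_le (p.dropUntil c hc)
  have h3 := hG.dist_triangle (u := s) (v := c) (w := z)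
  omega

theorem le_add_dist_of_adj_le {V : Type*} {G : SimpleGraph V} (hG : G.Connected) (f : V → ℕ)
    (hf : ∀ u w, G.Adj u w → f w ≤ f u + 1) (s z : V) : f z ≤ f s + G.dist s z := by
  obtain ⟨p, hp⟩ := hG.exists_walk_length_eq_dist s z
  rw [← hp]
  clear hp
  induction p with
  | nil => simp
  | cons h p ih =>
    have := hf _ _ h
    rw [Walk.length_cons]
    omega

theorem exists_adj_dist_add_one_eq {V : Type*} {G : SimpleGraph V} (hG : G.Connected) {s z : V}
    (hne : s ≠ z) : ∃ u, G.Adj z u ∧ G.dist s u + 1 = G.dist s z := by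
  obtain ⟨p, hp⟩ := hG.exists_walk_length_eq_dist z s
  cases p with
  | nil => exact absurd rfl hne
  | @cons _ u _ h p =>
    refine ⟨u, h, ?_⟩
    have h1 := dist_le p
    have h2 := hG.dist_triangle (u := z) (v := u) (w := s)
    rw [dist_eq_one_iff_adj.2 h] at h2
    rw [Walk.length_cons] at hp
    rw [dist_comm (u := s) (v := u), dist_comm (u := s) (v := z)]
    omega

section CyclicDistance

variable {g : ℕ}

/-- The distance between two vertices of a cycle of length `g`. -/
def cycDist (a b : ZMod g) : ℕ := min (a - b).val (b - a).val

/-- The distance from a vertex of a cycle of length `g` to the edge joining `i` and `i + 1`. -/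
def cycEdgeDist (a i : ZMod g) : ℕ := min (cycDist a i) (cycDist a (i + 1))

theorem cycDist_comm (a b : ZMod g) : cycDist a b = cycDist b a := min_comm _ _

theorem cycDist_self (a : ZMod g) : cycDist a a = 0 := by simp [cycDist]

variable [NeZero g]

theorem zmod_val_sub_cases (a b : ZMod g) :
    (b.val ≤ a.val ∧ (a - b).val + b.val = a.val) ∨
      (a.val < b.val ∧ (a - b).val + b.val = a.val + g) := by
  have ha := a.val_lt
  have hb := b.val_lt
  have hab := (a - b).val_lt
  rcases lt_or_ge ((a - b).val + b.val) g with h | h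
  · have := ZMod.val_add_of_lt h
    rw [sub_add_cancel] at this
    omega
  · have := ZMod.val_add_val_of_le h
    rw [sub_add_cancel] at this
    omega

theorem zmod_val_add_one_cases (hg : 3 ≤ g) (a : ZMod g) :
    (a.val + 1 < g ∧ (a + 1).val = a.val + 1) ∨ (a.val + 1 = g ∧ (a + 1).val = 0) := by
  have : Fact (1 < g) := ⟨by omega⟩
  have h1 : (1 : ZMod g).val = 1 := ZMod.val_one g
  have ha := a.val_lt
  rcases lt_or_ge (a.val + (1 : ZMod g).val) g with h | h
  · have := ZMod.val_add_of_lt h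
    omega
  · have := ZMod.val_add_val_of_le h
    omega

theorem cycDist_eq (a b : ZMod g) :
    (a.val ≤ b.val ∧ cycDist a b = min (b.val - a.val) (g - (b.val - a.val))) ∨
      (b.val < a.val ∧ cycDist a b = min (a.val - b.val) (g - (a.val - b.val))) := by
  have h1 := zmod_val_sub_cases a b
  have h2 := zmod_val_sub_cases b a
  have ha := a.val_lt
  have hb := b.val_lt
  have h3 := (a - b).val_lt
  have h4 := (b - a).val_lt
  unfold cycDist
  omega

theorem cycDist_triangle (a b c : ZMod g) : cycDist a c ≤ cycDist a b + cycDist b c := by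
  have ha := a.val_lt
  have hb := b.val_lt
  have hc := c.val_lt
  have h1 := cycDist_eq a b
  have h2 := cycDist_eq b c
  have h3 := cycDist_eq a c
  omega

theorem cycDist_add_one_le (hg : 3 ≤ g) (a : ZMod g) : cycDist a (a + 1) ≤ 1 := by
  have h1 := cycDist_eq a (a + 1)
  have h2 := zmod_val_add_one_cases hg a
  omega

theorem cycEdgeDist_le (a b i : ZMod g) : cycEdgeDist a i ≤ cycDist a b + cycEdgeDist b i := by
  have h1 := cycDist_triangle a b i
  have h2 := cycDist_triangle a b (i + 1)
  unfold cycEdgeDist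
  omega

theorem cycEdgeDist_eq (hg : 3 ≤ g) (a i : ZMod g) :
    (a.val ≤ i.val ∧ cycEdgeDist a i = min (i.val - a.val) (a.val + g - i.val - 1)) ∨
      (i.val < a.val ∧ cycEdgeDist a i = min (a.val - i.val - 1) (g + i.val - a.val)) := by
  have ha := a.val_lt
  have hi := i.val_lt
  have h1 := cycDist_eq a i
  have h2 := cycDist_eq a (i + 1)
  have h3 := zmod_val_add_one_cases hg i
  unfold cycEdgeDist
  omega

end CyclicDistance

/-- The distance from `x` to the cycle vertex at which its tree is rooted. -/
noncomputable def treeDepth {V : Type*} {g : ℕ} (G : SimpleGraph V) (vc : ZMod g → V)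
    (ix : V → ZMod g) (x : V) : ℕ := G.dist (vc (ix x)) x

/-- The graph `G` consists of the cycle `vc` with disjoint rooted trees hanging at its vertices:
`ix x` is the index of the cycle vertex at which the tree of `x` is rooted, and `par x` is the
parent of `x` in that tree. -/
structure IsTreeRooting {V : Type*} {g : ℕ} (G : SimpleGraph V) (vc : ZMod g → V)
    (ix : V → ZMod g) (par : V → V) : Prop where
  connected : G.Connected
  three_le : 3 ≤ g
  ix_root : ∀ i, ix (vc i) = i
  adj_succ : ∀ i, G.Adj (vc i) (vc (i + 1))
  adj_of_ix_ne : ∀ x y, G.Adj x y → ix x ≠ ix y →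
    x = vc (ix x) ∧ y = vc (ix y) ∧ (ix y = ix x + 1 ∨ ix x = ix y + 1)
  par_adj : ∀ x, x ≠ vc (ix x) → G.Adj x (par x)
  par_ix : ∀ x, x ≠ vc (ix x) → ix (par x) = ix x
  par_depth : ∀ x, x ≠ vc (ix x) → treeDepth G vc ix (par x) + 1 = treeDepth G vc ix x
  child_ix : ∀ x, x ≠ vc (ix x) → ∀ q, G.Adj x q → q ≠ par x → ix q = ix x
  child_depth : ∀ x, x ≠ vc (ix x) → ∀ q, G.Adj x q → q ≠ par x →
    treeDepth G vc ix q = treeDepth G vc ix x + 1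

/-- The descendants of `y` in its rooted tree, including `y` itself. -/
def treeDesc {V : Type*} {g : ℕ} (G : SimpleGraph V) (vc : ZMod g → V)
    (ix : V → ZMod g) (y : V) : Set V :=
  {z | ix z = ix y ∧ treeDepth G vc ix z = treeDepth G vc ix y + G.dist y z}

namespace IsTreeRooting

variable {V : Type*} {g : ℕ} {G : SimpleGraph V} {vc : ZMod g → V} {ix : V → ZMod g} {par : V → V}

local notation "δ" => treeDepth G vc ix

local notation "Desc" => treeDesc G vc ix

theorem self_mem_desc (y : V) : y ∈ Desc y := by simp [treeDesc]

theorem neZero (h : IsTreeRooting G vc ix par) : NeZero g := ⟨by have := h.three_le; omega⟩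

theorem depth_root (h : IsTreeRooting G vc ix par) (i : ZMod g) : δ (vc i) = 0 := by
  simp [treeDepth, h.ix_root]

theorem ne_root_of_depth_pos (h : IsTreeRooting G vc ix par) {x : V} (hx : 0 < δ x) :
    x ≠ vc (ix x) := by
  intro h'
  rw [h', h.depth_root] at hx
  omega

theorem depth_pos (h : IsTreeRooting G vc ix par) {x : V} (hx : x ≠ vc (ix x)) : 0 < δ x := by
  have := h.par_depth x hx
  omega

theorem eq_root_of_depth_eq_zero (h : IsTreeRooting G vc ix par) {x : V} (hx : δ x = 0) :
    x = vc (ix x) := by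
  by_contra h'
  have := h.depth_pos h'
  omega

theorem par_not_mem_desc (h : IsTreeRooting G vc ix par) {y : V} (hy : y ≠ vc (ix y)) :
    par y ∉ Desc y := by
  intro hmem
  have := h.par_depth y hy
  have := hmem.2
  omega

theorem depth_le (h : IsTreeRooting G vc ix par) {x y : V} (hxy : ix x = ix y) :
    δ x ≤ δ y + G.dist y x := by
  unfold treeDepth
  rw [hxy]
  exact h.connected.dist_triangle

theorem ne_root_of_mem_desc (h : IsTreeRooting G vc ix par) {y z : V} (hy : y ≠ vc (ix y))
    (hz : z ∈ Desc y) : z ≠ vc (ix z) := by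
  apply h.ne_root_of_depth_pos
  have := h.depth_pos hy
  have := hz.2
  omega

theorem desc_boundary (h : IsTreeRooting G vc ix par) {y u w : V} (hy : y ≠ vc (ix y))
    (hu : u ∈ Desc y) (hw : w ∉ Desc y) (ha : G.Adj u w) : u = y ∧ w = par y := by
  have hur := h.ne_root_of_mem_desc hy hu
  have hix : ix w = ix y := by
    by_cases hwp : w = par u
    · rw [hwp, h.par_ix u hur, hu.1]
    · rw [h.child_ix u hur w ha hwp, hu.1]
  by_cases hwp : w = par u
  · by_cases huy : u = y
    · exact ⟨huy, huy ▸ hwp⟩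
    · exfalso
      obtain ⟨v, hv, hd⟩ := exists_adj_dist_add_one_eq h.connected (Ne.symm huy)
      have hvu : v = par u := by
        by_contra hne
        have h1 := h.child_depth u hur v hv hne
        have h2 := h.child_ix u hur v hv hne
        have h3 := h.depth_le (h2.trans hu.1)
        have h4 := hu.2
        omega
      apply hw
      refine ⟨hix, ?_⟩
      have := h.par_depth u hur
      have := hu.2
      rw [hwp, ← hvu] at *
      omega
  · exfalso
    apply hw
    refine ⟨hix, ?_⟩
    have h1 := h.child_depth u hur w ha hwp
    have h2 := h.depth_le hix
    have h3 := hu.2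
    have h4 := h.connected.dist_triangle (u := y) (v := u) (w := w)
    rw [dist_eq_one_iff_adj.2 ha] at h4
    omega

theorem dist_of_mem_desc (h : IsTreeRooting G vc ix par) {y s z : V} (hy : y ≠ vc (ix y))
    (hs : s ∈ Desc y) (hz : z ∉ Desc y) : G.dist s z = G.dist s y + G.dist y z :=
  dist_eq_add_of_separates h.connected
    (fun _ hu _ hw ha => Or.inl (h.desc_boundary hy hu hw ha).1.symm) hs hz

theorem dist_par_of_not_mem_desc (h : IsTreeRooting G vc ix par) {y s : V} (hy : y ≠ vc (ix y))
    (hs : s ∉ Desc y) : G.dist s y = G.dist s (par y) + 1 := by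
  have h1 := dist_eq_add_of_separates h.connected (c := par y)
    (fun _ hu _ hw ha => Or.inr (h.desc_boundary hy hu hw ha).2.symm) (self_mem_desc y) hs
  rw [dist_eq_one_iff_adj.2 (h.par_adj y hy)] at h1
  rw [dist_comm, h1, dist_comm, add_comm]

theorem exists_child_of_mem_desc (h : IsTreeRooting G vc ix par) {y z : V} (hy : y ≠ vc (ix y))
    (hz : z ∈ Desc y) (hzy : z ≠ y) : ∃ u, G.Adj y u ∧ u ≠ par y ∧ z ∈ Desc u := by
  obtain ⟨u, hu, hd⟩ := exists_adj_dist_add_one_eq h.connected hzy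
  rw [dist_comm (u := z), dist_comm (u := z)] at hd
  have hup : u ≠ par y := by
    rintro rfl
    have h1 := h.par_depth y hy
    have h2 := h.depth_le (hz.1.trans (h.par_ix y hy).symm)
    have h3 := hz.2
    omega
  have h1 := h.child_ix y hy u hu hup
  have h2 := h.child_depth y hy u hu hup
  have h3 := hz.2
  exact ⟨u, hu, hup, hz.1.trans h1.symm, by omega⟩

theorem child_ne_root (h : IsTreeRooting G vc ix par) {y u : V} (hy : y ≠ vc (ix y))
    (hu : G.Adj y u) (hup : u ≠ par y) : u ≠ vc (ix u) := by
  apply h.ne_root_of_depth_pos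
  have := h.child_depth y hy u hu hup
  omega

theorem par_child (h : IsTreeRooting G vc ix par) {y u : V} (hy : y ≠ vc (ix y))
    (hu : G.Adj y u) (hup : u ≠ par y) : par u = y := by
  by_contra hne
  have h1 := h.child_depth y hy u hu hup
  have h2 := h.child_depth u (h.child_ne_root hy hu hup) y hu.symm (Ne.symm hne)
  omega

theorem desc_subset_desc_par (h : IsTreeRooting G vc ix par) {y : V} (hy : y ≠ vc (ix y)) :
    Desc y ⊆ Desc (par y) := by
  intro z hz
  have h1 := h.par_ix y hy
  refine ⟨hz.1.trans h1.symm, ?_⟩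
  have h2 := h.dist_of_mem_desc hy hz (h.par_not_mem_desc hy)
  rw [dist_eq_one_iff_adj.2 (h.par_adj y hy), dist_comm, dist_comm (u := z)] at h2
  have := h.par_depth y hy
  have := hz.2
  omega

theorem dist_root_of_ix_ne (h : IsTreeRooting G vc ix par) {s z : V} {i : ZMod g} (hs : ix s = i)
    (hz : ix z ≠ i) : G.dist s z = δ s + G.dist (vc i) z := by
  subst hs
  have := dist_eq_add_of_separates h.connected (B := {x | ix x = ix s}) (c := vc (ix s))
    (fun u hu w hw ha => Or.inl (by
      have h1 := (h.adj_of_ix_ne u w ha (by rw [hu]; exact Ne.symm hw)).1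
      rw [hu] at h1
      exact h1.symm)) rfl hz
  rw [this, dist_comm, treeDepth]

theorem dist_root_root (h : IsTreeRooting G vc ix par) (i j : ZMod g) :
    G.dist (vc i) (vc j) = cycDist i j := by
  have := h.neZero
  apply le_antisymm
  · have arc : ∀ (n : ℕ) (i : ZMod g), G.dist (vc i) (vc (i + n)) ≤ n := by
      intro n i
      induction n with
      | zero => simp
      | succ n ih =>
        have h1 := h.connected.dist_triangle (u := vc i) (v := vc (i + n)) (w := vc (i + n + 1))
        rw [dist_eq_one_iff_adj.2 (h.adj_succ (i + n))] at h1
        push_cast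
        rw [← add_assoc]
        omega
    have h1 := arc (j - i).val i
    have h2 := arc (i - j).val j
    rw [ZMod.natCast_zmod_val, add_sub_cancel] at h1 h2
    rw [dist_comm] at h2
    exact le_min h2 h1
  · have := le_add_dist_of_adj_le h.connected (fun x => cycDist i (ix x)) (by
      intro u w ha
      by_cases hne : ix u = ix w
      · simp [hne]
      · have h1 := cycDist_triangle i (ix u) (ix w)
        have h2 : cycDist (ix u) (ix w) ≤ 1 := by
          rcases (h.adj_of_ix_ne u w ha hne).2.2 with h2 | h2
          · rw [h2]; exact cycDist_add_one_le h.three_le _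
          · rw [h2, cycDist_comm]; exact cycDist_add_one_le h.three_le _
        omega) (vc i) (vc j)
    simpa [h.ix_root, cycDist_self] using this

theorem dist_root (h : IsTreeRooting G vc ix par) (s : V) (i : ZMod g) :
    G.dist s (vc i) = δ s + cycDist (ix s) i := by
  by_cases hi : ix s = i
  · subst hi
    rw [cycDist_self, dist_comm, treeDepth, add_zero]
  · rw [h.dist_root_of_ix_ne rfl (by rw [h.ix_root]; exact Ne.symm hi), h.dist_root_root]

theorem dist_of_ix_ne (h : IsTreeRooting G vc ix par) {s z : V} (hne : ix s ≠ ix z) :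
    G.dist s z = δ s + cycDist (ix s) (ix z) + δ z := by
  rw [h.dist_root_of_ix_ne rfl (Ne.symm hne), dist_comm, h.dist_root, cycDist_comm]
  omega

theorem edgeDist_cycle (h : IsTreeRooting G vc ix par) (s : V) (i : ZMod g) :
    edgeDist G s s(vc i, vc (i + 1)) = δ s + cycEdgeDist (ix s) i := by
  simp only [edgeDist, Sym2.lift_mk, h.dist_root, cycEdgeDist]
  omega

theorem edgeDist_of_mem_desc (h : IsTreeRooting G vc ix par) {y s : V} (hy : y ≠ vc (ix y))
    (hs : s ∈ Desc y) : edgeDist G s s(par y, y) + δ y = δ s := by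
  have h1 := h.dist_of_mem_desc hy hs (h.par_not_mem_desc hy)
  have h2 := hs.2
  simp only [edgeDist, Sym2.lift_mk]
  rw [dist_comm (u := s) (v := y)] at *
  omega

theorem edgeDist_of_not_mem_desc (h : IsTreeRooting G vc ix par) {y s : V} (hy : y ≠ vc (ix y))
    (hs : s ∉ Desc y) : edgeDist G s s(par y, y) = G.dist s (par y) := by
  have h1 := h.dist_par_of_not_mem_desc hy hs
  simp only [edgeDist, Sym2.lift_mk]
  omega

theorem edgeDist_of_ix_ne (h : IsTreeRooting G vc ix par) {y s : V} (hy : y ≠ vc (ix y))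
    (hs : ix s ≠ ix y) :
    edgeDist G s s(par y, y) = δ s + cycDist (ix s) (ix y) + δ (par y) := by
  rw [h.edgeDist_of_not_mem_desc hy (fun hm => hs hm.1),
    h.dist_of_ix_ne (by rwa [h.par_ix y hy]), h.par_ix y hy]

theorem edge_cases (h : IsTreeRooting G vc ix par) {e : Sym2 V} (he : e ∈ G.edgeSet) :
    (∃ i, e = s(vc i, vc (i + 1))) ∨ ∃ y, y ≠ vc (ix y) ∧ e = s(par y, y) := by
  induction e with
  | _ x y =>
  rw [mem_edgeSet] at he
  by_cases hne : ix x = ix y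
  · right
    by_cases hy : y = vc (ix y)
    · have hx : x ≠ vc (ix x) := by
        intro hx
        rw [hne] at hx
        exact he.ne (hx.trans hy.symm)
      refine ⟨x, hx, ?_⟩
      have : y = par x := by
        by_contra hyp
        exact h.child_ne_root hx he hyp hy
      rw [this, Sym2.eq_swap]
    · by_cases hx : x = par y
      · exact ⟨y, hy, by rw [hx]⟩
      · exact ⟨x, h.child_ne_root hy he.symm hx, by rw [h.par_child hy he.symm hx, Sym2.eq_swap]⟩
  · left
    obtain ⟨h1, h2, h3 | h3⟩ := h.adj_of_ix_ne x y he hne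
    · exact ⟨ix x, by rw [← h3, ← h1, ← h2]⟩
    · exact ⟨ix y, by rw [← h3, ← h1, ← h2, Sym2.eq_swap]⟩

end IsTreeRooting

/-- The list `t` is a path through descendants of `y` that starts at `y`, runs through vertices of
degree `2` and ends in a leaf. -/
structure IsDescPath {V : Type*} [Fintype V] {g : ℕ} (G : SimpleGraph V) [DecidableRel G.Adj]
    (vc : ZMod g → V) (ix : V → ZMod g) (y : V) (t : List V) : Prop where
  head_eq : t.head? = some y
  nodup : t.Nodup
  mem_desc : ∀ u ∈ t, u ∈ treeDesc G vc ix y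
  isChain : List.IsChain G.Adj t
  degree_last : ∀ u ∈ t.getLast?, G.degree u = 1
  degree_dropLast : ∀ u ∈ t.dropLast, G.degree u = 2

namespace IsTreeRooting

variable {V : Type*} [Fintype V] {g : ℕ} {G : SimpleGraph V} [DecidableRel G.Adj]
  {vc : ZMod g → V} {ix : V → ZMod g} {par : V → V} {S : Set V}

local notation "δ" => treeDepth G vc ix

local notation "Desc" => treeDesc G vc ix

theorem isThreadAt_of_isDescPath (h : IsTreeRooting G vc ix par) {y : V} (hy : y ≠ vc (ix y))
    {t : List V} (ht : IsDescPath G vc ix y t) (hdeg : 3 ≤ G.degree (par y)) :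
    IsThreadAt G (par y) t := by
  have hhead := ht.head_eq
  refine ⟨?_, ht.nodup, fun hm => h.par_not_mem_desc hy (ht.mem_desc _ hm), hdeg, ht.isChain, ?_,
    ht.degree_last, ht.degree_dropLast⟩
  · rintro rfl
    simp at hhead
  · intro u hu
    rw [hhead] at hu
    cases hu
    exact (h.par_adj y hy).symm

theorem par_eq_false_of_isDescPath (h : IsTreeRooting G vc ix par) (hbr : BranchResolving G S)
    {y z : V} (hy : y ≠ vc (ix y)) (hz : z ≠ vc (ix z)) (hyz : y ≠ z) (hpar : par y = par z)
    (hdeg : 3 ≤ G.degree (par y)) (hyS : ∀ s ∈ S, s ∉ Desc y) (hzS : ∀ s ∈ S, s ∉ Desc z)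
    {t t' : List V} (ht : IsDescPath G vc ix y t) (ht' : IsDescPath G vc ix z t') : False := by
  have hne : t ≠ t' := by
    rintro rfl
    have := ht.head_eq.symm.trans ht'.head_eq
    simp only [Option.some.injEq] at this
    exact hyz this
  rcases hbr (par y) t t' (h.isThreadAt_of_isDescPath hy ht hdeg)
    (hpar ▸ h.isThreadAt_of_isDescPath hz ht' (hpar ▸ hdeg)) hne with ⟨s, hs, hst⟩ | ⟨s, hs, hst⟩
  · exact hyS s hs (ht.mem_desc s hst)
  · exact hzS s hs (ht'.mem_desc s hst)

theorem exists_isDescPath (h : IsTreeRooting G vc ix par) (hbr : BranchResolving G S) {y : V}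
    (hy : y ≠ vc (ix y)) (hS : ∀ s ∈ S, s ∉ Desc y) :
    ∃ t, IsDescPath G vc ix y t ∧ (Desc y).ncard ≤ t.length := by
  classical
  induction hn : (Desc y).ncard using Nat.strong_induction_on generalizing y with
  | _ n ih =>
  subst hn
  have hchild : ∀ u, G.Adj y u → u ≠ par y → u ≠ vc (ix u) ∧ par u = y ∧ Desc u ⊆ Desc y ∧
      y ∉ Desc u ∧ (∀ s ∈ S, s ∉ Desc u) ∧ ∃ t, IsDescPath G vc ix u t ∧
        (Desc u).ncard ≤ t.length := by
    intro u hu hup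
    have h1 := h.child_ne_root hy hu hup
    have h2 := h.par_child hy hu hup
    have h3 := h.desc_subset_desc_par h1
    have h4 := h.par_not_mem_desc h1
    rw [h2] at h3 h4
    have h5 : ∀ s ∈ S, s ∉ Desc u := fun s hs hm => hS s hs (h3 hm)
    refine ⟨h1, h2, h3, h4, h5, ih _ ?_ h1 h5 rfl⟩
    exact Set.ncard_lt_ncard ⟨h3, fun hsub => h4 (hsub (self_mem_desc y))⟩ (Set.toFinite _)
  have hcard : ((G.neighborFinset y).erase (par y)).card + 1 = G.degree y := by
    rw [Finset.card_erase_add_one (by simpa using h.par_adj y hy), card_neighborFinset_eq_degree]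
  have hmem : ∀ u, u ∈ (G.neighborFinset y).erase (par y) ↔ G.Adj y u ∧ u ≠ par y := by
    intro u
    simp [and_comm]
  rcases Nat.lt_or_ge 1 ((G.neighborFinset y).erase (par y)).card with hc | hc
  · obtain ⟨u, hu, v, hv, huv⟩ := Finset.one_lt_card.1 hc
    rw [hmem] at hu hv
    obtain ⟨u1, u2, -, -, u5, t, ht, -⟩ := hchild u hu.1 hu.2
    obtain ⟨v1, v2, -, -, v5, t', ht', -⟩ := hchild v hv.1 hv.2
    exact (h.par_eq_false_of_isDescPath hbr u1 v1 huv (u2.trans v2.symm) (by rw [u2]; omega)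
      u5 v5 ht ht').elim
  · rcases Nat.eq_zero_or_pos ((G.neighborFinset y).erase (par y)).card with hc0 | hc0
    · have hD : Desc y ⊆ {y} := by
        intro z hz
        by_contra hzy
        obtain ⟨u, hu, hup, -⟩ := h.exists_child_of_mem_desc hy hz hzy
        have := (hmem u).2 ⟨hu, hup⟩
        rw [Finset.card_eq_zero.1 hc0] at this
        simp at this
      refine ⟨[y], ⟨rfl, by simp, by simpa using self_mem_desc y, by simp, ?_, by simp⟩, ?_⟩
      · simp
        omega
      · simpa using Set.ncard_le_ncard hD
    · obtain ⟨u, hu⟩ := Finset.card_eq_one.1 (le_antisymm hc hc0)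
      have hu' := (hmem u).1 (by simp [hu])
      obtain ⟨-, -, u3, u4, -, t, ht, htl⟩ := hchild u hu'.1 hu'.2
      have hD : Desc y ⊆ insert y (Desc u) := by
        intro z hz
        by_cases hzy : z = y
        · exact Or.inl hzy
        · obtain ⟨v, hv, hvp, hzv⟩ := h.exists_child_of_mem_desc hy hz hzy
          have := (hmem v).2 ⟨hv, hvp⟩
          rw [hu, Finset.mem_singleton] at this
          exact Or.inr (this ▸ hzv)
      have hhead := ht.head_eq
      have hnil : t ≠ [] := by
        rintro rfl
        simp at hhead
      refine ⟨y :: t, ⟨rfl, ?_, ?_, ?_, ?_, ?_⟩, ?_⟩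
      · exact List.nodup_cons.2 ⟨fun hm => u4 (ht.mem_desc y hm), ht.nodup⟩
      · intro v hv
        rcases List.mem_cons.1 hv with rfl | hv
        · exact self_mem_desc v
        · exact u3 (ht.mem_desc v hv)
      · rw [List.isChain_cons]
        refine ⟨fun v hv => ?_, ht.isChain⟩
        rw [hhead] at hv
        cases hv
        exact hu'.1
      · rw [List.getLast?_cons_of_ne_nil hnil]
        exact ht.degree_last
      · rw [List.dropLast_cons_of_ne_nil hnil]
        intro v hv
        rcases List.mem_cons.1 hv with rfl | hv
        · have : ((G.neighborFinset v).erase (par v)).card = 1 := by simp [hu]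
          omega
        · exact ht.degree_dropLast v hv
      · have h1 := Set.ncard_le_ncard hD
        have h2 := Set.ncard_insert_le y (Desc u)
        rw [List.length_cons]
        omega

theorem three_le_degree_root (h : IsTreeRooting G vc ix par) {y : V} (hy : y ≠ vc (ix y))
    (hroot : par y = vc (ix y)) : 3 ≤ G.degree (par y) := by
  classical
  have := h.neZero
  have h3 := h.three_le
  have hsub : {y, vc (ix y + 1), vc (ix y - 1)} ⊆ G.neighborFinset (par y) := by
    intro u hu
    simp only [Finset.mem_insert, Finset.mem_singleton] at hu
    rw [mem_neighborFinset]
    rcases hu with rfl | rfl | rfl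
    · exact (h.par_adj u hy).symm
    · rw [hroot]; exact h.adj_succ _
    · rw [hroot]
      simpa using (h.adj_succ (ix y - 1)).symm
  rw [← card_neighborFinset_eq_degree]
  refine le_trans ?_ (Finset.card_le_card hsub)
  have hv1 := zmod_val_add_one_cases h3 (ix y)
  have hv2 := zmod_val_add_one_cases h3 (ix y - 1)
  rw [sub_add_cancel] at hv2
  have hlt := (ix y).val_lt
  have hlt' := (ix y - 1).val_lt
  have hinj : ∀ i j : ZMod g, i.val ≠ j.val → vc i ≠ vc j := by
    intro i j hij heq
    have := congrArg ix heq
    rw [h.ix_root, h.ix_root] at this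
    exact hij (by rw [this])
  have hyv : ∀ i, y ≠ vc i := by
    intro i hi
    apply hy
    rw [hi, h.ix_root]
  rw [Finset.card_eq_three.2 ⟨y, vc (ix y + 1), vc (ix y - 1), hyv _, hyv _,
    hinj _ _ (by omega), rfl⟩]

theorem false_of_same_tree (h : IsTreeRooting G vc ix par) (hbr : BranchResolving G S)
    {y z : V} (hy : y ≠ vc (ix y)) (hz : z ≠ vc (ix z)) (hyz : y ≠ z) (hix : ix y = ix z)
    (hdepth : δ y = δ z) (hyS : ∀ s ∈ S, s ∉ Desc y) (hzS : ∀ s ∈ S, s ∉ Desc z)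
    (hdist : ∀ s ∈ S, G.dist s y = G.dist s z) : False := by
  classical
  induction hn : δ y generalizing y z with
  | zero => exact hy (h.eq_root_of_depth_eq_zero hn)
  | succ n ih =>
    have hpy := h.par_depth y hy
    have hpz := h.par_depth z hz
    have hiy := h.par_ix y hy
    have hiz := h.par_ix z hz
    by_cases hpar : par y = par z
    · have hdeg : 3 ≤ G.degree (par y) := by
        by_cases hr : par y = vc (ix y)
        · exact h.three_le_degree_root hy hr
        · have hr' : par y ≠ vc (ix (par y)) := by rwa [hiy]
          have hsub : {par (par y), y, z} ⊆ G.neighborFinset (par y) := by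
            intro u hu
            simp only [Finset.mem_insert, Finset.mem_singleton] at hu
            rw [mem_neighborFinset]
            rcases hu with rfl | rfl | rfl
            · exact h.par_adj _ hr'
            · exact (h.par_adj u hy).symm
            · rw [hpar]
              exact (h.par_adj u hz).symm
          rw [← card_neighborFinset_eq_degree]
          refine le_trans ?_ (Finset.card_le_card hsub)
          have hpp := h.par_depth _ hr'
          rw [Finset.card_eq_three.2 ⟨par (par y), y, z, ?_, ?_, hyz, rfl⟩]
          · intro heq; rw [heq] at hpp; omega
          · intro heq; rw [heq] at hpp; omega
      obtain ⟨t, ht, -⟩ := h.exists_isDescPath hbr hy hyS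
      obtain ⟨t', ht', -⟩ := h.exists_isDescPath hbr hz hzS
      exact h.par_eq_false_of_isDescPath hbr hy hz hyz hpar hdeg hyS hzS ht ht'
    · have hd : ∀ s ∈ S, G.dist s (par y) = G.dist s (par z) := by
        intro s hs
        have h1 := h.dist_par_of_not_mem_desc hy (hyS s hs)
        have h2 := h.dist_par_of_not_mem_desc hz (hzS s hs)
        have h3 := hdist s hs
        omega
      have hry : par y ≠ vc (ix (par y)) := by
        intro hr
        have h0 : δ (par z) = 0 := by
          have := h.depth_root (ix (par y))
          rw [← hr] at this
          omega
        apply hpar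
        rw [hr, h.eq_root_of_depth_eq_zero h0, hiy, hiz, hix]
      have hrz : par z ≠ vc (ix (par z)) := by
        apply h.ne_root_of_depth_pos
        have := h.depth_pos hry
        omega
      have aux : ∀ {a b : V}, a ≠ vc (ix a) → a ≠ b → δ a = δ b →
          (∀ s ∈ S, G.dist s a = G.dist s b) → ∀ s ∈ S, s ∉ Desc a := by
        intro a b ha hab hdab hd s hs hm
        have hpos := h.connected.pos_dist_of_ne hab
        have hb : b ∉ Desc a := by
          intro hb
          have := hb.2
          omega
        have h1 := h.dist_of_mem_desc ha hm hb
        have h2 := hd s hs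
        omega
      have hdp : δ (par y) = δ (par z) := by omega
      exact ih hry hrz hpar (by rw [hiy, hiz, hix]) hdp (aux hry hpar hdp hd)
        (aux hrz (Ne.symm hpar) hdp.symm (fun s hs => (hd s hs).symm)) hd (by omega)

theorem exists_thread_at_root (h : IsTreeRooting G vc ix par) (hbr : BranchResolving G S) {y : V}
    (hy : y ≠ vc (ix y)) (hyS : ∀ s ∈ S, s ∉ Desc y)
    (hdist : ∀ s ∈ S, ix s = ix y → G.dist s (par y) = δ s + δ (par y)) :
    ∃ t, IsThreadAt G (vc (ix y)) t ∧ SFree S t ∧ δ (par y) + (Desc y).ncard ≤ t.length := by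
  induction hn : δ (par y) generalizing y with
  | zero =>
    have hiy := h.par_ix y hy
    have hr := h.eq_root_of_depth_eq_zero hn
    rw [hiy] at hr
    obtain ⟨t, ht, hl⟩ := h.exists_isDescPath hbr hy hyS
    refine ⟨t, ?_, fun u hu hus => hyS u hus (ht.mem_desc u hu), by omega⟩
    have := h.isThreadAt_of_isDescPath hy ht (h.three_le_degree_root hy hr)
    rwa [hr] at this
  | succ n ih =>
    have hiy := h.par_ix y hy
    have hr : par y ≠ vc (ix (par y)) := h.ne_root_of_depth_pos (by omega)
    have hpS : ∀ s ∈ S, s ∉ Desc (par y) := by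
      intro s hs hm
      have h1 := hdist s hs (hm.1.trans hiy)
      have h2 := hm.2
      rw [dist_comm] at h2
      omega
    have hpp := h.par_depth _ hr
    obtain ⟨t, ht, htS, hl⟩ := ih hr hpS (by
      intro s hs hsi
      have h1 := hdist s hs (hsi.trans hiy)
      have h2 := h.dist_par_of_not_mem_desc hr (hpS s hs)
      omega) (by omega)
    rw [hiy] at ht
    refine ⟨t, ht, htS, ?_⟩
    have hlt : (Desc y).ncard < (Desc (par y)).ncard :=
      Set.ncard_lt_ncard ⟨h.desc_subset_desc_par hy,
        fun hsub => h.par_not_mem_desc hy (hsub (self_mem_desc _))⟩ (Set.toFinite _)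
    omega

/-- An edge of a tree that `S` does not distinguish from an edge `f` outside that tree gives rise
to an `S`-free thread at the root of the tree. -/
theorem exists_thread_of_forall_edgeDist_eq (h : IsTreeRooting G vc ix par)
    (hbr : BranchResolving G S) {y : V} (hy : y ≠ vc (ix y)) {f : Sym2 V} {c : ℕ}
    (heq : ∀ s ∈ S, edgeDist G s s(par y, y) = edgeDist G s f)
    (hf : ∀ s ∈ S, ix s = ix y → edgeDist G s f = δ s + c)
    (hc : ∀ s ∈ S, ix s = ix y → δ (par y) ≤ c) :
    (∃ t, IsThreadAt G (vc (ix y)) t ∧ SFree S t ∧ δ (par y) + 1 ≤ t.length) ∧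
      ∀ s ∈ S, ix s = ix y → δ (par y) = c := by
  have hyS : ∀ s ∈ S, s ∉ Desc y := by
    intro s hs hm
    have h1 := h.edgeDist_of_mem_desc hy hm
    have h2 := heq s hs
    have h3 := hf s hs hm.1
    have h4 := h.depth_pos hy
    omega
  have hd : ∀ s ∈ S, ix s = ix y → G.dist s (par y) = δ s + c ∧ δ (par y) = c := by
    intro s hs hi
    have h1 := h.edgeDist_of_not_mem_desc hy (hyS s hs)
    have h2 := heq s hs
    have h3 := hf s hs hi
    have h4 := hc s hs hi
    have h5 := h.connected.dist_triangle (u := s) (v := vc (ix s)) (w := par y)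
    rw [dist_comm (u := s) (v := vc (ix s))] at h5
    have h6 : G.dist (vc (ix s)) (par y) = δ (par y) := by
      rw [treeDepth, h.par_ix y hy, hi]
    have h7 : G.dist (vc (ix s)) s = δ s := rfl
    omega
  refine ⟨?_, fun s hs hi => (hd s hs hi).2⟩
  obtain ⟨t, ht, htS, hl⟩ := h.exists_thread_at_root hbr hy hyS (by
    intro s hs hi
    have := hd s hs hi
    omega)
  have : 0 < (Desc y).ncard := (Set.ncard_pos (Set.toFinite _)).2 ⟨y, self_mem_desc y⟩
  exact ⟨t, ht, htS, by omega⟩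

end IsTreeRooting

section Existence

variable {V : Type*} {G : SimpleGraph V} {g : ℕ} {vc : ZMod g → V}

theorem reachable_arc {H : SimpleGraph V} (i : ZMod g) (n : ℕ)
    (hadj : ∀ m < n, H.Adj (vc (i + m)) (vc (i + m + 1))) :
    H.Reachable (vc i) (vc (i + n)) := by
  induction n with
  | zero => simp
  | succ n ih =>
    have := (ih fun m hm => hadj m (by omega)).trans (hadj n (by omega)).reachable
    push_cast
    rwa [← add_assoc]

theorem natCast_zmod_ne_zero {m : ℕ} (h0 : 0 < m) (hm : m < g) : (m : ZMod g) ≠ 0 := by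
  rw [Ne, ZMod.natCast_eq_zero_iff]
  exact Nat.not_dvd_of_pos_of_lt h0 hm

theorem IsCycleLabelling.edge_injective (hg : 3 ≤ g) (hvc : IsCycleLabelling G g vc)
    {i j : ZMod g} (h : s(vc i, vc (i + 1)) = s(vc j, vc (j + 1))) : i = j := by
  rcases Sym2.eq_iff.1 h with ⟨h, -⟩ | ⟨h1, h2⟩
  · exact hvc.1 h
  · have h1 := hvc.1 h1
    have h2 := hvc.1 h2
    exfalso
    apply natCast_zmod_ne_zero (g := g) (m := 2) (by omega) (by omega)
    rw [h1] at h2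
    push_cast
    linear_combination h2

theorem IsUnicyclic.isAcyclic_deleteEdges (hG : IsUnicyclic G) (hg : 3 ≤ g)
    (hvc : IsCycleLabelling G g vc) (i : ZMod g) :
    (G.deleteEdges {s(vc i, vc (i + 1))}).IsAcyclic := by
  have hreach : (G.deleteEdges {s(vc i, vc (i + 1))}).Reachable (vc i) (vc (i + 1)) := by
    have := reachable_arc (H := G.deleteEdges {s(vc i, vc (i + 1))}) (vc := vc) (i + 1) (g - 1) (by
      intro m hm
      rw [deleteEdges_adj]
      refine ⟨hvc.2 _, fun heq => ?_⟩
      have := hvc.edge_injective hg (Set.mem_singleton_iff.1 heq)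
      apply natCast_zmod_ne_zero (g := g) (m := m + 1) (by omega) (by omega)
      push_cast
      linear_combination this)
    have hi : i + 1 + ((g - 1 : ℕ) : ZMod g) = i := by
      rw [Nat.cast_sub (by omega)]
      simp
    rw [hi] at this
    exact this.symm
  obtain ⟨u, p, hp, hmem⟩ :=
    adj_and_reachable_delete_edges_iff_exists_cycle.1 ⟨hvc.2 i, hreach⟩
  intro v c hc
  have hc' : (c.mapLe (deleteEdges_le _)).IsCycle := hc.mapLe _
  have h1 := (hG.2.2 _ _ _ _ hp hc' _).1 hmem
  rw [Walk.edges_mapLe_eq_edges] at h1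
  have h2 := c.edges_subset_edgeSet h1
  simp at h2

theorem IsUnicyclic.inTree_unique (hG : IsUnicyclic G) (hg : 3 ≤ g)
    (hvc : IsCycleLabelling G g vc) {x : V} {i j : ZMod g} (hi : inTree G g vc i x)
    (hj : inTree G g vc j x) : i = j := by
  have : NeZero g := ⟨by omega⟩
  by_contra hne
  have hij : (offCycle G g vc).Reachable (vc i) (vc j) := hi.trans hj.symm
  set H := G.deleteEdges {s(vc (i - 1), vc (i - 1 + 1))} with hH
  have hone : (1 : ZMod g) ≠ 0 := by
    simpa using natCast_zmod_ne_zero (g := g) (m := 1) (by omega) (by omega)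
  have hadj : H.Adj (vc i) (vc (i + 1)) := by
    rw [hH, deleteEdges_adj]
    refine ⟨hvc.2 i, fun heq => ?_⟩
    have := hvc.edge_injective hg (Set.mem_singleton_iff.1 heq)
    apply hone
    linear_combination this
  have hbridge := isBridge_iff.1
    (isAcyclic_iff_forall_adj_isBridge.1 (hG.isAcyclic_deleteEdges hg hvc (i - 1)) hadj)
  apply hbridge
  have hle : offCycle G g vc ≤ H.deleteEdges {s(vc i, vc (i + 1))} := by
    intro a b hab
    rw [offCycle, deleteEdges_adj] at hab
    rw [hH, deleteEdges_adj, deleteEdges_adj]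
    refine ⟨⟨hab.1, fun heq => hab.2 ⟨i - 1, heq⟩⟩, fun heq => hab.2 ⟨i, heq⟩⟩
  refine (hij.mono hle).trans ?_
  have hm0 : 0 < (j - i).val := by
    rw [Nat.pos_iff_ne_zero, Ne, ZMod.val_eq_zero, sub_eq_zero]
    exact Ne.symm hne
  have hmlt := (j - i).val_lt
  have := reachable_arc (H := H.deleteEdges {s(vc i, vc (i + 1))}) (vc := vc) (i + 1)
    ((j - i).val - 1) (by
      intro m hm
      rw [hH, deleteEdges_adj, deleteEdges_adj]
      refine ⟨⟨hvc.2 _, fun heq => ?_⟩, fun heq => ?_⟩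
      · have := hvc.edge_injective hg (Set.mem_singleton_iff.1 heq)
        apply natCast_zmod_ne_zero (g := g) (m := m + 2) (by omega) (by omega)
        push_cast
        linear_combination this
      · have := hvc.edge_injective hg (Set.mem_singleton_iff.1 heq)
        apply natCast_zmod_ne_zero (g := g) (m := m + 1) (by omega) (by omega)
        push_cast
        linear_combination this)
  have hj' : i + 1 + (((j - i).val - 1 : ℕ) : ZMod g) = j := by
    rw [Nat.cast_sub (by omega), ZMod.natCast_zmod_val]
    push_cast
    ring
  rw [hj'] at this
  exact this.symm

theorem exists_inTree (hG : G.Connected) (x : V) : ∃ i, inTree G g vc i x := by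
  obtain ⟨p⟩ := hG.preconnected (vc 0) x
  have key : ∀ {u x : V} (_ : G.Walk u x), (∃ i, inTree G g vc i u) → ∃ i, inTree G g vc i x := by
    intro u x p
    induction p with
    | nil => exact id
    | @cons u w _ hadj p ih =>
      rintro ⟨i, hi⟩
      apply ih
      by_cases hc : s(u, w) ∈ cycleEdges g vc
      · obtain ⟨j, hj⟩ := hc
        rcases Sym2.eq_iff.1 hj with ⟨-, h⟩ | ⟨-, h⟩
        · exact ⟨j + 1, h ▸ Reachable.refl _⟩
        · exact ⟨j, h ▸ Reachable.refl _⟩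
      · exact ⟨i, hi.trans (Adj.reachable (by rw [offCycle, deleteEdges_adj]; exact ⟨hadj, hc⟩))⟩
  exact key p ⟨0, Reachable.refl _⟩

theorem reachable_offCycle_deleteEdges_of_dist_le (hG : G.Connected) {ix : V → ZMod g}
    (hoff : ∀ x, x ≠ vc (ix x) → ∀ q, G.Adj x q → (offCycle G g vc).Adj x q ∧ ix q = ix x)
    {x y w : V} (hxy : x ≠ y) (hix : ix x = ix y) (hle : treeDepth G vc ix x ≤ treeDepth G vc ix y) :
    ((offCycle G g vc).deleteEdges {s(y, w)}).Reachable (vc (ix y)) x := by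
  induction hn : treeDepth G vc ix x generalizing x with
  | zero =>
    have h0 := hn
    rw [treeDepth, (hG _ _).dist_eq_zero_iff] at h0
    rw [← hix, h0]
  | succ n ih =>
    have hx : x ≠ vc (ix x) := by
      intro h
      rw [treeDepth, ← h, SimpleGraph.dist_self] at hn
      omega
    obtain ⟨u, hu, hd⟩ := exists_adj_dist_add_one_eq hG (Ne.symm hx)
    obtain ⟨hoff1, hix1⟩ := hoff x hx u hu
    have hun : treeDepth G vc ix u = n := by
      unfold treeDepth at hn ⊢
      rw [hix1]
      omega
    have huy : u ≠ y := by
      rintro rfl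
      omega
    refine (ih huy (hix1.trans hix) (by omega) hun).trans (Adj.reachable ?_)
    rw [deleteEdges_adj]
    refine ⟨hoff1.symm, fun heq => ?_⟩
    rcases Sym2.eq_iff.1 (Set.mem_singleton_iff.1 heq) with ⟨h, -⟩ | ⟨-, h⟩
    · exact huy h
    · exact hxy h

theorem IsUnicyclic.exists_isTreeRooting (hG : IsUnicyclic G) (hg : 3 ≤ g)
    (hvc : IsCycleLabelling G g vc) :
    ∃ (ix : V → ZMod g) (par : V → V), IsTreeRooting G vc ix par ∧
      ∀ i x, inTree G g vc i x ↔ ix x = i := by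
  classical
  have hconn := hG.1
  choose ix hix using fun x => exists_inTree (g := g) (vc := vc) hconn x
  have hiff : ∀ i x, inTree G g vc i x ↔ ix x = i := fun i x =>
    ⟨fun h => hG.inTree_unique hg hvc (hix x) h, fun h => h ▸ hix x⟩
  have hroot : ∀ i, ix (vc i) = i := fun i => (hiff i (vc i)).1 (Reachable.refl _)
  have hadjoff : ∀ x q, (offCycle G g vc).Adj x q → ix q = ix x := fun x q ha =>
    (hiff _ _).1 ((hix x).trans ha.reachable)
  have hoff : ∀ x, x ≠ vc (ix x) → ∀ q, G.Adj x q →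
      (offCycle G g vc).Adj x q ∧ ix q = ix x := by
    intro x hx q ha
    have : (offCycle G g vc).Adj x q := by
      rw [offCycle, deleteEdges_adj]
      refine ⟨ha, ?_⟩
      rintro ⟨i, hi⟩
      rcases Sym2.eq_iff.1 hi with ⟨h, -⟩ | ⟨h, -⟩ <;>
        exact hx (by rw [h, hroot])
    exact ⟨this, hadjoff x q this⟩
  have hacyc : (offCycle G g vc).IsAcyclic := by
    refine (hG.isAcyclic_deleteEdges hg hvc 0).anti ?_
    intro a b hab
    rw [offCycle, deleteEdges_adj] at hab
    rw [deleteEdges_adj]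
    exact ⟨hab.1, fun heq => hab.2 ⟨0, heq⟩⟩
  have hpar : ∀ x, ∃ p, x ≠ vc (ix x) → G.Adj x p ∧
      treeDepth G vc ix p + 1 = treeDepth G vc ix x := by
    intro x
    by_cases hx : x = vc (ix x)
    · exact ⟨x, fun h => absurd hx h⟩
    · obtain ⟨p, hp, hd⟩ := exists_adj_dist_add_one_eq hconn (Ne.symm hx)
      refine ⟨p, fun _ => ⟨hp, ?_⟩⟩
      unfold treeDepth
      rwa [(hoff x hx p hp).2]
  choose par hpar using hpar
  refine ⟨ix, par, ⟨hconn, hg, hroot, hvc.2, ?_, fun x hx => (hpar x hx).1,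
    fun x hx => (hoff x hx _ (hpar x hx).1).2, fun x hx => (hpar x hx).2,
    fun x hx q hq _ => (hoff x hx q hq).2, ?_⟩, hiff⟩
  · intro x y ha hne
    have hmem : s(x, y) ∈ cycleEdges g vc := by
      by_contra hc
      exact hne (hadjoff x y (by rw [offCycle, deleteEdges_adj]; exact ⟨ha, hc⟩)).symm
    obtain ⟨i, hi⟩ := hmem
    rcases Sym2.eq_iff.1 hi with ⟨rfl, rfl⟩ | ⟨rfl, rfl⟩ <;> simp [hroot]
  · intro x hx q hq hqp
    obtain ⟨hp, hpd⟩ := hpar x hx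
    obtain ⟨hqo, hqi⟩ := hoff x hx q hq
    obtain ⟨hpo, hpi⟩ := hoff x hx _ hp
    have hup : treeDepth G vc ix q ≤ treeDepth G vc ix x + 1 := by
      have := hconn.dist_triangle (u := vc (ix x)) (v := x) (w := q)
      rw [dist_eq_one_iff_adj.2 hq] at this
      unfold treeDepth
      rwa [hqi]
    refine le_antisymm hup ?_
    by_contra hlt
    have hbridge := isBridge_iff.1 (isAcyclic_iff_forall_adj_isBridge.1 hacyc hpo)
    apply hbridge
    have h1 := reachable_offCycle_deleteEdges_of_dist_le hconn hoff (w := par x) hq.ne.symm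
      hqi (by omega)
    have h2 := reachable_offCycle_deleteEdges_of_dist_le hconn hoff (w := par x) hp.ne.symm
      hpi (by omega)
    refine (Adj.reachable ?_).trans (h1.symm.trans h2)
    rw [deleteEdges_adj]
    refine ⟨hqo, fun heq => ?_⟩
    rcases Sym2.eq_iff.1 (Set.mem_singleton_iff.1 heq) with ⟨-, h⟩ | ⟨-, h⟩
    · exact hqp h
    · exact hq.ne h.symm

end Existence

section CycleCombinatorics

variable {g : ℕ}

theorem cycDist_sub_right (a b c : ZMod g) : cycDist (a - c) (b - c) = cycDist a b := by
  simp [cycDist]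

theorem cycEdgeDist_sub_right (a i c : ZMod g) :
    cycEdgeDist (a - c) (i - c) = cycEdgeDist a i := by
  rw [cycEdgeDist, cycEdgeDist, cycDist_sub_right, ← cycDist_sub_right a (i + 1) c]
  congr 2
  ring

variable [NeZero g]

theorem cycDist_eq_min_val_sub (a i : ZMod g) :
    cycDist a i = min (a - i).val (g - (a - i).val) := by
  rw [← cycDist_sub_right a i i, sub_self]
  have h := cycDist_eq (a - i) 0
  rw [ZMod.val_zero] at h
  omega

theorem val_sub_rev_cases (a i : ZMod g) :
    ((a - i).val = 0 ∧ (i - a).val = 0) ∨ (0 < (a - i).val ∧ (i - a).val + (a - i).val = g) := by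
  have h := zmod_val_sub_cases 0 (a - i)
  rw [zero_sub, neg_sub, ZMod.val_zero] at h
  omega

theorem val_sub_ne {a b : ZMod g} (h : a ≠ b) (c : ZMod g) : (a - c).val ≠ (b - c).val :=
  fun h' => h (by simpa using ZMod.val_injective g h')

theorem eq_of_two_vertices_cases {a i j : ZMod g} {p q : ℕ}
    (h : cycDist a i + p = cycDist a j + q) :
    p = q + cycDist i j ∨ q = p + cycDist i j ∨
      2 * (a - i).val + p = (j - i).val + q ∨ 2 * (a - i).val + q = g + (j - i).val + p := by
  have h1 := cycDist_eq_min_val_sub a i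
  have h2 := cycDist_eq (a - i) (j - i)
  rw [cycDist_sub_right] at h2
  have h3 := cycDist_eq_min_val_sub j i
  rw [cycDist_comm] at h3
  have hx := (a - i).val_lt
  have hD := (j - i).val_lt
  omega

theorem subset_arc_of_cycDist_eq {P : ZMod g → Prop} {i j : ZMod g} {p q : ℕ} (hij : i ≠ j)
    (h : ∀ a, P a → cycDist a i + p = cycDist a j + q) {a b c : ZMod g} (ha : P a) (hb : P b)
    (hc : P c) (hab : a ≠ b) (hac : a ≠ c) (hbc : b ≠ c) :
    (∀ x, P x → (x - i).val ≤ (g - 1) / 2) ∨ (∀ x, P x → (i - x).val ≤ (g - 1) / 2) ∨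
      (∀ x, P x → (x - j).val ≤ (g - 1) / 2) ∨ (∀ x, P x → (j - x).val ≤ (g - 1) / 2) := by
  have hext : p = q + cycDist i j ∨ q = p + cycDist i j := by
    have h1 := eq_of_two_vertices_cases (h a ha)
    have h2 := eq_of_two_vertices_cases (h b hb)
    have h3 := eq_of_two_vertices_cases (h c hc)
    have h4 := val_sub_ne hab i
    have h5 := val_sub_ne hac i
    have h6 := val_sub_ne hbc i
    omega
  have aux : ∀ {i j : ZMod g} {p q : ℕ}, i ≠ j →
      (∀ a, P a → cycDist a i + p = cycDist a j + q) → p = q + cycDist i j →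
      (∀ x, P x → (x - i).val ≤ (g - 1) / 2) ∨ (∀ x, P x → (i - x).val ≤ (g - 1) / 2) := by
    intro i j p q hij h hpq
    have h0 := val_sub_ne hij.symm i
    rw [sub_self, ZMod.val_zero] at h0
    have hD := (j - i).val_lt
    have h3 := cycDist_eq_min_val_sub j i
    rw [cycDist_comm] at h3
    rcases le_total (2 * (j - i).val) g with hs | hs
    · right
      intro x hx
      have h1 := cycDist_eq_min_val_sub x i
      have h2 := cycDist_eq (x - i) (j - i)
      rw [cycDist_sub_right] at h2
      have h4 := val_sub_rev_cases x i
      have h5 := h x hx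
      have hxl := (x - i).val_lt
      omega
    · left
      intro x hx
      have h1 := cycDist_eq_min_val_sub x i
      have h2 := cycDist_eq (x - i) (j - i)
      rw [cycDist_sub_right] at h2
      have h5 := h x hx
      have hxl := (x - i).val_lt
      omega
  rcases hext with hext | hext
  · rcases aux hij h hext with h | h
    · exact Or.inl h
    · exact Or.inr (Or.inl h)
  · rw [cycDist_comm] at hext
    rcases aux hij.symm (fun a ha => (h a ha).symm) hext with h | h
    · exact Or.inr (Or.inr (Or.inl h))
    · exact Or.inr (Or.inr (Or.inr h))

theorem eq_of_vertex_edge_cases (hg : 3 ≤ g) {a i j : ZMod g} {p : ℕ}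
    (h : cycEdgeDist a j = cycDist a i + p) :
    p = (j - i).val ∨ p + (j - i).val + 1 = g ∨
      2 * (a - i).val + p = (j - i).val ∨ 2 * (a - i).val = g + (j - i).val + 1 + p := by
  have h1 := cycDist_eq_min_val_sub a i
  have h2 := cycEdgeDist_eq hg (a - i) (j - i)
  rw [cycEdgeDist_sub_right] at h2
  have hx := (a - i).val_lt
  have hD := (j - i).val_lt
  omega

theorem subset_arc_of_cycEdgeDist_eq (hg : 3 ≤ g) {P : ZMod g → Prop} {i j : ZMod g} {p : ℕ}
    (h : ∀ a, P a → cycEdgeDist a j = cycDist a i + p) {a b c : ZMod g} (ha : P a) (hb : P b)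
    (hc : P c) (hab : a ≠ b) (hac : a ≠ c) (hbc : b ≠ c) :
    (∀ x, P x → (x - i).val ≤ (g - 1) / 2) ∨ (∀ x, P x → (i - x).val ≤ (g - 1) / 2) := by
  have hext : p = (j - i).val ∨ p + (j - i).val + 1 = g := by
    have h1 := eq_of_vertex_edge_cases hg (h a ha)
    have h2 := eq_of_vertex_edge_cases hg (h b hb)
    have h3 := eq_of_vertex_edge_cases hg (h c hc)
    have h4 := val_sub_ne hab i
    have h5 := val_sub_ne hac i
    have h6 := val_sub_ne hbc i
    omega
  have hD := (j - i).val_lt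
  rcases hext with hext | hext
  · right
    intro x hx
    have h1 := cycDist_eq_min_val_sub x i
    have h2 := cycEdgeDist_eq hg (x - i) (j - i)
    rw [cycEdgeDist_sub_right] at h2
    have h4 := val_sub_rev_cases x i
    have h5 := h x hx
    have hxl := (x - i).val_lt
    omega
  · left
    intro x hx
    have h1 := cycDist_eq_min_val_sub x i
    have h2 := cycEdgeDist_eq hg (x - i) (j - i)
    rw [cycEdgeDist_sub_right] at h2
    have h5 := h x hx
    have hxl := (x - i).val_lt
    omega

theorem false_of_cycEdgeDist_eq_three (hg : 3 ≤ g) {P : ZMod g → Prop} {i j : ZMod g} (hij : i ≠ j)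
    (h : ∀ a, P a → cycEdgeDist a i = cycEdgeDist a j) {a b c : ZMod g} (ha : P a) (hb : P b)
    (hc : P c) (hab : a ≠ b) (hac : a ≠ c) (hbc : b ≠ c) : False := by
  have h0 := val_sub_ne hij.symm i
  rw [sub_self, ZMod.val_zero] at h0
  have hD := (j - i).val_lt
  have key : ∀ x, P x → 2 * (x - i).val = (j - i).val + 1 ∨
      2 * (x - i).val = (j - i).val + 1 + g ∨ 2 * (x - i).val + g = (j - i).val + 1 := by
    intro x hx
    have h1 := cycEdgeDist_eq hg (x - i) (j - i)
    have h2 := cycEdgeDist_eq hg (x - i) (i - i)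
    rw [cycEdgeDist_sub_right] at h1 h2
    rw [sub_self, ZMod.val_zero] at h2
    have h3 := h x hx
    have hxl := (x - i).val_lt
    omega
  have h1 := key a ha
  have h2 := key b hb
  have h3 := key c hc
  have h4 := val_sub_ne hab i
  have h5 := val_sub_ne hac i
  have h6 := val_sub_ne hbc i
  have := (a - i).val_lt
  have := (b - i).val_lt
  have := (c - i).val_lt
  omega

theorem false_of_cycEdgeDist_eq_two (hg : 3 ≤ g) {κ i j : ZMod g} (hij : i ≠ j) (hk : 0 < κ.val)
    (hk' : κ.val ≤ (g + 1) / 2 - 1) (h0 : cycEdgeDist 0 i = cycEdgeDist 0 j)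
    (h1 : cycEdgeDist κ i = cycEdgeDist κ j) : False := by
  have hv : i.val ≠ j.val := fun h => hij (ZMod.val_injective g h)
  have hi := i.val_lt
  have hj := j.val_lt
  have e1 := cycEdgeDist_eq hg 0 i
  have e2 := cycEdgeDist_eq hg 0 j
  have e3 := cycEdgeDist_eq hg κ i
  have e4 := cycEdgeDist_eq hg κ j
  rw [ZMod.val_zero] at e1 e2
  omega

theorem odd_of_cycEdgeDist_eq_two (hg : 3 ≤ g) {κ i j : ZMod g} {p : ℕ} (hk : 0 < κ.val)
    (hk' : κ.val ≤ (g + 1) / 2 - 1) (h0 : cycEdgeDist 0 j = cycDist 0 i + p)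
    (h1 : cycEdgeDist κ j = cycDist κ i + p)
    (hi : ¬ ((κ.val ≤ i.val ∧ i.val ≤ (g + 1) / 2 - 1) ∨
      (g / 2 + κ.val + 1 ≤ i.val ∧ i.val ≤ g - 1) ∨ i.val = 0)) :
    i.val ≤ κ.val ∧ g / 2 - κ.val + 1 ≤ p + 1 ∧ ¬ Even g := by
  rw [Nat.even_iff]
  have hil := i.val_lt
  have hj := j.val_lt
  have e1 := cycDist_eq 0 i
  have e2 := cycEdgeDist_eq hg 0 j
  have e3 := cycDist_eq κ i
  have e4 := cycEdgeDist_eq hg κ j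
  rw [ZMod.val_zero] at e1 e2
  omega

theorem cycDist_cases_of_outside {κ i : ZMod g} (hk : 0 < κ.val)
    (hk' : κ.val ≤ (g + 1) / 2 - 1)
    (hi : ¬ ((κ.val ≤ i.val ∧ i.val ≤ (g + 1) / 2 - 1) ∨
      (g / 2 + κ.val + 1 ≤ i.val ∧ i.val ≤ g - 1) ∨ i.val = 0)) :
    (i.val < κ.val ∧ cycDist 0 i = i.val ∧ cycDist κ i + i.val = κ.val) ∨
      (κ.val < i.val ∧ cycDist 0 i + i.val = g ∧ cycDist κ i + κ.val = i.val) := by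
  have hil := i.val_lt
  have e1 := cycDist_eq 0 i
  have e3 := cycDist_eq κ i
  rw [ZMod.val_zero] at e1
  omega

theorem opposite_of_cycDist_eq_two {κ i j : ZMod g} {p q : ℕ} (hij : i ≠ j) (hk : 0 < κ.val)
    (hk' : κ.val ≤ (g + 1) / 2 - 1) (h0 : cycDist 0 i + p = cycDist 0 j + q)
    (h1 : cycDist κ i + p = cycDist κ j + q)
    (hi : ¬ ((κ.val ≤ i.val ∧ i.val ≤ (g + 1) / 2 - 1) ∨
      (g / 2 + κ.val + 1 ≤ i.val ∧ i.val ≤ g - 1) ∨ i.val = 0))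
    (hj : ¬ ((κ.val ≤ j.val ∧ j.val ≤ (g + 1) / 2 - 1) ∨
      (g / 2 + κ.val + 1 ≤ j.val ∧ j.val ≤ g - 1) ∨ j.val = 0)) :
    (i.val ≤ κ.val ∧ g / 2 - κ.val + 1 ≤ p + 1 ∧ j.val = g / 2 + κ.val - i.val) ∨
      (j.val ≤ κ.val ∧ g / 2 - κ.val + 1 ≤ q + 1 ∧ i.val = g / 2 + κ.val - j.val) := by
  have hv : i.val ≠ j.val := fun h => hij (ZMod.val_injective g h)
  rcases cycDist_cases_of_outside hk hk' hi with ⟨_, _, _⟩ | ⟨_, _, _⟩ <;>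
    rcases cycDist_cases_of_outside hk hk' hj with ⟨_, _, _⟩ | ⟨_, _, _⟩ <;> omega

end CycleCombinatorics

section CanonicalLabelling

variable {V : Type*} {G : SimpleGraph V} {g : ℕ} {vc : ZMod g → V} {S : Set V}

theorem cycleEdges_shift (a : ZMod g) : cycleEdges g (fun t => vc (t + a)) = cycleEdges g vc := by
  ext e
  constructor
  · rintro ⟨i, rfl⟩
    exact ⟨i + a, by rw [add_right_comm]⟩
  · rintro ⟨i, rfl⟩
    exact ⟨i - a, by simp [sub_add_cancel, sub_add_eq_add_sub]⟩

theorem sActive_shift (a i : ZMod g) :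
    SActive G g (fun t => vc (t + a)) S i ↔ SActive G g vc S (i + a) := by
  simp only [SActive, inTree, offCycle, cycleEdges_shift]

theorem IsCycleLabelling.shift (h : IsCycleLabelling G g vc) (a : ZMod g) :
    IsCycleLabelling G g (fun t => vc (t + a)) := by
  refine ⟨fun x y hxy => add_right_cancel (h.1 hxy), fun i => ?_⟩
  simpa only [add_right_comm] using h.2 (i + a)

variable [NeZero g]

theorem kOf_spec (h0 : SActive G g vc S 0) :
    kOf G g vc S < g ∧ SActive G g vc S (kOf G g vc S : ZMod g) :=
  Nat.sSup_mem (s := {n : ℕ | n < g ∧ SActive G g vc S (n : ZMod g)})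
    ⟨0, NeZero.pos g, by simpa using h0⟩ ⟨g, fun _ hn => hn.1.le⟩

theorem val_kOf (h0 : SActive G g vc S 0) : (kOf G g vc S : ZMod g).val = kOf G g vc S :=
  ZMod.val_cast_of_lt (kOf_spec h0).1

theorem val_le_kOf {a : ZMod g} (ha : SActive G g vc S a) : a.val ≤ kOf G g vc S :=
  le_csSup ⟨g, fun _ hn => hn.1.le⟩ ⟨a.val_lt, by rwa [ZMod.natCast_zmod_val]⟩

theorem Canonical.kOf_le_of_val_sub_le (hcan : Canonical G g vc S) {c : ZMod g} {L : ℕ}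
    (h : ∀ a, SActive G g vc S a → (a - c).val ≤ L) : kOf G g vc S ≤ L := by
  obtain ⟨b, hb, hmin⟩ := Set.exists_min_image {a | SActive G g vc S a} (fun a => (a - c).val)
    (Set.toFinite _) ⟨0, hcan.2.1⟩
  have hb0 : SActive G g (fun t => vc (t + b)) S 0 := by
    rw [sActive_shift, zero_add]
    exact hb
  refine (hcan.2.2 _ (hcan.1.shift b) ?_ hb0).trans ?_
  · exact (Equiv.addRight b).surjective.range_comp vc
  · have hs := kOf_spec hb0
    have hv := val_kOf hb0
    set k := kOf G g (fun t => vc (t + b)) S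
    rw [sActive_shift] at hs
    have h1 := h _ hs.2
    have h2 := hmin _ hs.2
    have h3 : (k : ZMod g).val = ((k + b - c : ZMod g) - (b - c)).val := by congr 1; ring
    rw [ZMod.val_sub h2, hv] at h3
    omega

theorem Canonical.kOf_le_of_val_rev_sub_le (hcan : Canonical G g vc S) {c : ZMod g} {L : ℕ}
    (h : ∀ a, SActive G g vc S a → (c - a).val ≤ L) : kOf G g vc S ≤ L := by
  rcases lt_or_ge L g with hL | hL
  · refine hcan.kOf_le_of_val_sub_le (c := c - L) fun a ha => ?_
    have h1 := h a ha
    have h2 : a - (c - L) = L - (c - a) := by ring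
    rw [h2, ZMod.val_sub (by rwa [ZMod.val_cast_of_lt hL]), ZMod.val_cast_of_lt hL]
    omega
  · exact (kOf_spec hcan.2.1).1.le.trans hL

theorem Biactive.exists_active_ne (hbi : Biactive G g vc S) (j : ZMod g) :
    ∃ a, SActive G g vc S a ∧ a ≠ j := by
  by_contra! h
  have hsub : {a | SActive G g vc S a} ⊆ {j} := h
  have := Set.ncard_le_ncard hsub (Set.toFinite _)
  rw [Set.ncard_singleton] at this
  have h2 : 2 ≤ {a | SActive G g vc S a}.ncard := hbi
  omega

theorem Biactive.kOf_pos (hbi : Biactive G g vc S) : 0 < kOf G g vc S := by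
  obtain ⟨a, ha, hne⟩ := hbi.exists_active_ne 0
  have := val_le_kOf ha
  have := (ZMod.val_ne_zero a).2 hne
  omega

theorem Canonical.two_or_three_active (hcan : Canonical G g vc S)
    (hbi : Biactive G g vc S) (hA : ¬ ConfigA G g vc S) :
    (aS G g vc S = 2 ∧ kOf G g vc S ≤ (g + 1) / 2 - 1) ∨
      ∃ a b c, SActive G g vc S a ∧ SActive G g vc S b ∧ SActive G g vc S c ∧
        a ≠ b ∧ a ≠ c ∧ b ≠ c := by
  have h2 : 2 ≤ aS G g vc S := hbi
  rcases h2.lt_or_eq with h3 | h3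
  · right
    obtain ⟨a, b, c, ha, hb, hc, h⟩ := (Set.two_lt_ncard_iff (Set.toFinite _)).1 h3
    exact ⟨a, b, c, ha, hb, hc, h⟩
  · left
    refine ⟨h3.symm, ?_⟩
    have hk0 := hbi.kOf_pos
    have hks := kOf_spec hcan.2.1
    have hkv := val_kOf hcan.2.1
    have hne : (0 : ZMod g) ≠ (kOf G g vc S : ZMod g) := by
      intro h
      rw [← h, ZMod.val_zero] at hkv
      omega
    have heq : {0, (kOf G g vc S : ZMod g)} = {a | SActive G g vc S a} := by
      apply Set.eq_of_subset_of_ncard_le _ _ (Set.toFinite _)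
      · rintro a (rfl | rfl)
        exacts [hcan.2.1, hks.2]
      · rw [Set.ncard_pair hne]
        exact h3.symm.le
    have hle : kOf G g vc S ≤ g - kOf G g vc S := by
      apply hcan.kOf_le_of_val_sub_le (c := (kOf G g vc S : ZMod g))
      intro a ha
      have ha' : a ∈ ({0, (kOf G g vc S : ZMod g)} : Set (ZMod g)) := heq ▸ ha
      rcases ha' with rfl | rfl
      · have := zmod_val_sub_cases 0 (kOf G g vc S : ZMod g)
        rw [hkv, ZMod.val_zero] at this
        omega
      · simp
    by_contra hlt
    exact hA ⟨h3.symm, by rw [Nat.even_iff]; omega, by omega⟩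

theorem Canonical.false_of_cycEdgeDist_eq (hg : 3 ≤ g) (hcan : Canonical G g vc S)
    (hbi : Biactive G g vc S) (hA : ¬ ConfigA G g vc S) {i j : ZMod g} (hij : i ≠ j)
    (h : ∀ a, SActive G g vc S a → cycEdgeDist a i = cycEdgeDist a j) : False := by
  rcases hcan.two_or_three_active hbi hA with ⟨-, hk⟩ | ⟨a, b, c, ha, hb, hc, hab, hac, hbc⟩
  · have hkv := val_kOf hcan.2.1
    have hk0 := hbi.kOf_pos
    exact false_of_cycEdgeDist_eq_two hg hij (by omega) (by omega) (h 0 hcan.2.1)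
      (h _ (kOf_spec hcan.2.1).2)
  · exact false_of_cycEdgeDist_eq_three hg hij h ha hb hc hab hac hbc

variable [Fintype V] [DecidableRel G.Adj]

theorem Canonical.configD_of_arc (hcan : Canonical G g vc S) {c : ZMod g} {t : List V}
    (ht : IsThreadAt G (vc c) t) (hS : SFree S t)
    (h : (∀ a, SActive G g vc S a → (a - c).val ≤ (g - 1) / 2) ∨
      ∀ a, SActive G g vc S a → (c - a).val ≤ (g - 1) / 2) : ConfigD G g vc S := by
  have hks := kOf_spec hcan.2.1
  have hkv := val_kOf hcan.2.1
  have hcl := c.val_lt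
  have hc : vc (c.val : ZMod g) = vc c := by rw [ZMod.natCast_zmod_val]
  rcases h with h | h
  · have hk := hcan.kOf_le_of_val_sub_le h
    have h0 := h 0 hcan.2.1
    have h1 := h _ hks.2
    have e0 := zmod_val_sub_cases 0 c
    have e1 := zmod_val_sub_cases (kOf G g vc S : ZMod g) c
    rw [ZMod.val_zero] at e0
    exact ⟨by omega, c.val, by omega, t, by rwa [hc], hS⟩
  · have hk := hcan.kOf_le_of_val_rev_sub_le h
    have h0 := h 0 hcan.2.1
    have h1 := h _ hks.2
    have e1 := zmod_val_sub_cases c (kOf G g vc S : ZMod g)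
    rw [sub_zero] at h0
    exact ⟨by omega, c.val, by omega, t, by rwa [hc], hS⟩

theorem Canonical.not_in_arc_of_not_configD (hcan : Canonical G g vc S)
    (hk : kOf G g vc S ≤ (g + 1) / 2 - 1) (hD : ¬ ConfigD G g vc S) {i : ZMod g} {t : List V}
    (ht : IsThreadAt G (vc i) t) (hS : SFree S t) :
    ¬ (((kOf G g vc S : ZMod g).val ≤ i.val ∧ i.val ≤ (g + 1) / 2 - 1) ∨
      (g / 2 + (kOf G g vc S : ZMod g).val + 1 ≤ i.val ∧ i.val ≤ g - 1) ∨ i.val = 0) := by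
  rw [val_kOf hcan.2.1]
  exact fun hi => hD ⟨hk, i.val, hi, t, by rwa [ZMod.natCast_zmod_val], hS⟩

theorem Canonical.config_of_cycEdgeDist_eq_cycDist (hg : 3 ≤ g) (hcan : Canonical G g vc S)
    (hbi : Biactive G g vc S) {i j : ZMod g} {p : ℕ}
    (h : ∀ a, SActive G g vc S a → cycEdgeDist a j = cycDist a i + p) {t : List V}
    (ht : IsThreadAt G (vc i) t) (hS : SFree S t) (hp : p + 1 ≤ t.length) :
    ConfigA G g vc S ∨ ConfigD G g vc S ∨ ConfigE G g vc S := by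
  by_contra! ⟨hA, hD, hE⟩
  rcases hcan.two_or_three_active hbi hA with ⟨h2, hk⟩ | ⟨a, b, c, ha, hb, hc, hab, hac, hbc⟩
  · have hkv := val_kOf hcan.2.1
    have hk0 := hbi.kOf_pos
    obtain ⟨h3, h4, h5⟩ := odd_of_cycEdgeDist_eq_two hg (by omega) (by omega) (h 0 hcan.2.1)
      (h _ (kOf_spec hcan.2.1).2) (hcan.not_in_arc_of_not_configD hk hD ht hS)
    exact hE ⟨h2, i.val, by omega, ⟨t, by rwa [ZMod.natCast_zmod_val], hS, by omega⟩,
      fun he => absurd he h5⟩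
  · exact hD (hcan.configD_of_arc ht hS
      (subset_arc_of_cycEdgeDist_eq hg h ha hb hc hab hac hbc))

theorem Canonical.config_of_cycDist_eq (hg : 3 ≤ g) (hcan : Canonical G g vc S)
    (hbi : Biactive G g vc S) {i j : ZMod g} {p q : ℕ} (hij : i ≠ j)
    (h : ∀ a, SActive G g vc S a → cycDist a i + p = cycDist a j + q) {t t' : List V}
    (ht : IsThreadAt G (vc i) t) (hS : SFree S t) (hp : p + 1 ≤ t.length)
    (ht' : IsThreadAt G (vc j) t') (hS' : SFree S t') (hq : q + 1 ≤ t'.length) :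
    ConfigA G g vc S ∨ ConfigD G g vc S ∨ ConfigE G g vc S := by
  by_contra! ⟨hA, hD, hE⟩
  rcases hcan.two_or_three_active hbi hA with ⟨h2, hk⟩ | ⟨a, b, c, ha, hb, hc, hab, hac, hbc⟩
  · have hkv := val_kOf hcan.2.1
    have hk0 := hbi.kOf_pos
    rcases opposite_of_cycDist_eq_two hij (by omega) (by omega) (h 0 hcan.2.1)
      (h _ (kOf_spec hcan.2.1).2) (hcan.not_in_arc_of_not_configD hk hD ht hS)
      (hcan.not_in_arc_of_not_configD hk hD ht' hS') with ⟨h3, h4, h5⟩ | ⟨h3, h4, h5⟩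
    · rw [hkv] at h5
      exact hE ⟨h2, i.val, by omega, ⟨t, by rwa [ZMod.natCast_zmod_val], hS, by omega⟩,
        fun _ => ⟨t', by rwa [← h5, ZMod.natCast_zmod_val], hS'⟩⟩
    · rw [hkv] at h5
      exact hE ⟨h2, j.val, by omega, ⟨t', by rwa [ZMod.natCast_zmod_val], hS', by omega⟩,
        fun _ => ⟨t, by rwa [← h5, ZMod.natCast_zmod_val], hS⟩⟩
  · rcases subset_arc_of_cycDist_eq hij h ha hb hc hab hac hbc with h | h | h | h
    · exact hD (hcan.configD_of_arc ht hS (Or.inl h))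
    · exact hD (hcan.configD_of_arc ht hS (Or.inr h))
    · exact hD (hcan.configD_of_arc ht' hS' (Or.inl h))
    · exact hD (hcan.configD_of_arc ht' hS' (Or.inr h))

end CanonicalLabelling

namespace IsTreeRooting

variable {V : Type*} {g : ℕ} {G : SimpleGraph V} {vc : ZMod g → V} {ix : V → ZMod g} {par : V → V}
  {S : Set V}

local notation "δ" => treeDepth G vc ix
local notation "Desc" => treeDesc G vc ix

theorem not_mem_desc_of_edgeDist_eq (h : IsTreeRooting G vc ix par) {y z s : V}
    (hy : y ≠ vc (ix y)) (hyz : y ≠ z) (hdepth : δ y = δ z) (hpar : δ (par z) < δ y)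
    (heq : edgeDist G s s(par y, y) = edgeDist G s s(par z, z)) :
    s ∉ Desc y := by
  intro hs
  have hzn : z ∉ Desc y := by
    intro hz
    have h1 := hz.2
    have h2 := h.connected.pos_dist_of_ne hyz
    omega
  have hpn : par z ∉ Desc y := by
    intro hz
    have h1 := hz.2
    omega
  have h1 := h.dist_of_mem_desc hy hs hzn
  have h2 := h.dist_of_mem_desc hy hs hpn
  have h3 := h.connected.pos_dist_of_ne hyz
  have h4 : 0 < G.dist y (par z) := h.connected.pos_dist_of_ne fun h5 => by
    rw [← h5] at hpar
    omega
  simp only [edgeDist, Sym2.lift_mk] at heq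
  omega

theorem edgeDist_le_of_ix_eq (h : IsTreeRooting G vc ix par) {z s : V} (hz : z ≠ vc (ix z))
    (hs : ix s = ix z) : edgeDist G s s(par z, z) ≤ δ s + δ (par z) := by
  have h1 : G.dist s (par z) ≤ G.dist s (vc (ix z)) + G.dist (vc (ix z)) (par z) :=
    h.connected.dist_triangle
  rw [h.dist_root, hs, cycDist_self] at h1
  simp only [edgeDist, Sym2.lift_mk]
  simp only [treeDepth, h.par_ix z hz] at h1 ⊢
  omega

variable [Fintype V] [DecidableRel G.Adj]

theorem false_of_edgeDist_eq_same_tree (h : IsTreeRooting G vc ix par) (hbr : BranchResolving G S)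
    {y z : V} (hy : y ≠ vc (ix y)) (hz : z ≠ vc (ix z)) (hyz : y ≠ z) (hix : ix y = ix z)
    (hother : ∃ s ∈ S, ix s ≠ ix y)
    (heq : ∀ s ∈ S, edgeDist G s s(par y, y) = edgeDist G s s(par z, z)) : False := by
  have hpy := h.par_depth y hy
  have hpz := h.par_depth z hz
  obtain ⟨s, hs, hsy⟩ := hother
  have h1 := heq s hs
  rw [h.edgeDist_of_ix_ne hy hsy, h.edgeDist_of_ix_ne hz (hix ▸ hsy), hix] at h1
  have hyS : ∀ s ∈ S, s ∉ Desc y := fun s hs =>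
    h.not_mem_desc_of_edgeDist_eq hy hyz (by omega) (by omega) (heq s hs)
  have hzS : ∀ s ∈ S, s ∉ Desc z := fun s hs =>
    h.not_mem_desc_of_edgeDist_eq hz hyz.symm (by omega) (by omega) (heq s hs).symm
  refine h.false_of_same_tree hbr hy hz hyz hix (by omega) hyS hzS fun s hs => ?_
  rw [h.dist_par_of_not_mem_desc hy (hyS s hs), h.dist_par_of_not_mem_desc hz (hzS s hs),
    ← h.edgeDist_of_not_mem_desc hy (hyS s hs), ← h.edgeDist_of_not_mem_desc hz (hzS s hs), heq s hs]

theorem exists_thread_of_edgeDist_eq_cycle (h : IsTreeRooting G vc ix par)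
    (hbr : BranchResolving G S) {y : V} (hy : y ≠ vc (ix y)) {i : ZMod g}
    (hother : ∃ s ∈ S, ix s ≠ ix y)
    (heq : ∀ s ∈ S, edgeDist G s s(par y, y) = edgeDist G s s(vc i, vc (i + 1))) :
    (∃ t, IsThreadAt G (vc (ix y)) t ∧ SFree S t ∧ δ (par y) + 1 ≤ t.length) ∧
      ∀ s ∈ S, cycEdgeDist (ix s) i = cycDist (ix s) (ix y) + δ (par y) := by
  have := h.neZero
  have hne : ∀ s ∈ S, ix s ≠ ix y →
      cycEdgeDist (ix s) i = cycDist (ix s) (ix y) + δ (par y) := by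
    intro s hs hsy
    have h1 := heq s hs
    rw [h.edgeDist_of_ix_ne hy hsy, h.edgeDist_cycle] at h1
    omega
  obtain ⟨s, hs, hsy⟩ := hother
  obtain ⟨ht, hc⟩ := h.exists_thread_of_forall_edgeDist_eq hbr hy (c := cycEdgeDist (ix y) i) heq
    (fun s _ hsy => by rw [h.edgeDist_cycle, hsy])
    (fun _ _ _ => by
      have h1 := hne s hs hsy
      have h2 := cycEdgeDist_le (ix s) (ix y) i
      omega)
  refine ⟨ht, fun s hs => ?_⟩
  by_cases hsy : ix s = ix y
  · rw [hsy, cycDist_self, zero_add, hc s hs hsy]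
  · exact hne s hs hsy

theorem exists_thread_of_edgeDist_eq_tree (h : IsTreeRooting G vc ix par)
    (hbr : BranchResolving G S) {y z : V} (hy : y ≠ vc (ix y)) (hz : z ≠ vc (ix z))
    (hyz : ix y ≠ ix z) (hother : ∃ s ∈ S, ix s ≠ ix y)
    (heq : ∀ s ∈ S, edgeDist G s s(par y, y) = edgeDist G s s(par z, z)) :
    (∃ t, IsThreadAt G (vc (ix y)) t ∧ SFree S t ∧ δ (par y) + 1 ≤ t.length) ∧
      ∀ s ∈ S, ix s = ix y → δ (par y) = cycDist (ix y) (ix z) + δ (par z) := by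
  have := h.neZero
  obtain ⟨s, hs, hsy⟩ := hother
  refine h.exists_thread_of_forall_edgeDist_eq hbr hy heq
    (fun s _ hsy => by rw [h.edgeDist_of_ix_ne hz (hsy ▸ hyz), hsy, add_assoc]) fun _ _ _ => ?_
  have h1 := heq s hs
  rw [h.edgeDist_of_ix_ne hy hsy] at h1
  by_cases hsz : ix s = ix z
  · have h2 := h.edgeDist_le_of_ix_eq hz hsz
    omega
  · rw [h.edgeDist_of_ix_ne hz hsz] at h1
    have h2 := cycDist_triangle (ix s) (ix y) (ix z)
    omega

theorem cycDist_eq_of_edgeDist_eq (h : IsTreeRooting G vc ix par) (hbr : BranchResolving G S)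
    {y z : V} (hy : y ≠ vc (ix y)) (hz : z ≠ vc (ix z)) (hyz : ix y ≠ ix z)
    (hothery : ∃ s ∈ S, ix s ≠ ix y) (hotherz : ∃ s ∈ S, ix s ≠ ix z)
    (heq : ∀ s ∈ S, edgeDist G s s(par y, y) = edgeDist G s s(par z, z)) :
    ∀ s ∈ S, cycDist (ix s) (ix y) + δ (par y) = cycDist (ix s) (ix z) + δ (par z) := by
  intro s hs
  by_cases hsy : ix s = ix y
  · rw [hsy, cycDist_self, zero_add]
    exact (h.exists_thread_of_edgeDist_eq_tree hbr hy hz hyz hothery heq).2 s hs hsy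
  · by_cases hsz : ix s = ix z
    · rw [hsz, cycDist_self, zero_add]
      exact ((h.exists_thread_of_edgeDist_eq_tree hbr hz hy hyz.symm hotherz
        fun s hs => (heq s hs).symm).2 s hs hsz).symm
    · have h1 := heq s hs
      rw [h.edgeDist_of_ix_ne hy hsy, h.edgeDist_of_ix_ne hz hsz] at h1
      omega

end IsTreeRooting

theorem statement_8 {V : Type*} [Fintype V] [DecidableEq V] (G : SimpleGraph V)
    [DecidableRel G.Adj] (hG : IsUnicyclic G) (g : ℕ) (hg : 3 ≤ g)
    (vc : ZMod g → V) (hvc : IsCycleLabelling G g vc)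
    (S : Set V) (hbr : BranchResolving G S) (hbi : Biactive G g vc S)
    (hcan : Canonical G g vc S)
    (hconf : ¬ (ConfigA G g vc S ∨ ConfigD G g vc S ∨ ConfigE G g vc S)) :
    IsEdgeMG G S := by
  obtain ⟨ix, par, h, hix⟩ := hG.exists_isTreeRooting hg hvc
  have := h.neZero
  have hact : ∀ {P : ZMod g → Prop}, (∀ s ∈ S, P (ix s)) → ∀ a, SActive G g vc S a → P a := by
    rintro P hP a ⟨s, hs, ha⟩
    exact (hix a s).1 ha ▸ hP s hs
  have hother : ∀ j, ∃ s ∈ S, ix s ≠ j := by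
    intro j
    obtain ⟨a, ⟨s, hs, ha⟩, hne⟩ := hbi.exists_active_ne j
    exact ⟨s, hs, ((hix a s).1 ha).symm ▸ hne⟩
  have hcycle_tree : ∀ i y, y ≠ vc (ix y) →
      ¬ ∀ s ∈ S, edgeDist G s s(par y, y) = edgeDist G s s(vc i, vc (i + 1)) := by
    intro i y hy heq
    obtain ⟨⟨t, ht, hS, hl⟩, hd⟩ := h.exists_thread_of_edgeDist_eq_cycle hbr hy (hother _) heq
    exact hconf (hcan.config_of_cycEdgeDist_eq_cycDist hg hbi (hact hd) ht hS hl)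
  intro e he f hf hef
  by_contra! heq
  rcases h.edge_cases he with ⟨i, rfl⟩ | ⟨y, hy, rfl⟩ <;>
    rcases h.edge_cases hf with ⟨j, rfl⟩ | ⟨z, hz, rfl⟩
  · refine hcan.false_of_cycEdgeDist_eq hg hbi (fun hA => hconf (Or.inl hA)) (i := i) (j := j)
      (by rintro rfl; exact hef rfl) (hact fun s hs => ?_)
    have h1 := heq s hs
    rw [h.edgeDist_cycle, h.edgeDist_cycle] at h1
    omega
  · exact hcycle_tree i z hz fun s hs => (heq s hs).symm
  · exact hcycle_tree j y hy heq
  · by_cases hyz : ix y = ix z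
    · exact h.false_of_edgeDist_eq_same_tree hbr hy hz (by rintro rfl; exact hef rfl) hyz
        (hother _) heq
    · obtain ⟨⟨t, ht, hS, hl⟩, -⟩ :=
        h.exists_thread_of_edgeDist_eq_tree hbr hy hz hyz (hother _) heq
      obtain ⟨⟨t', ht', hS', hl'⟩, -⟩ := h.exists_thread_of_edgeDist_eq_tree hbr hz hy
        (Ne.symm hyz) (hother _) fun s hs => (heq s hs).symm
      exact hconf (hcan.config_of_cycDist_eq hg hbi hyz
        (hact (h.cycDist_eq_of_edgeDist_eq hbr hy hz hyz (hother _) (hother _) heq))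
        ht hS hl ht' hS' hl')
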